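/- Let F be a field of characteristic p ≠ 2 and let λ be a partition of n−1. Then the blocks of the endomorphism algebra End_{FΣ_n}(S^λ↑^{Σ_n}) are parametrized by the p-residues of the addable nodes of [λ]: for each p-residue r of an addable node of λ, the corresponding block is isomorphic as an F-algebra to the truncated polynomial ring F[x]/(x^m), where m is the number of addable nodes of [λ] with p-residue r; in particular its F-dimension equals m. -/

import Mathlib

namespace CarterPayne

open Finset

/-- A partition of `n`, presented by its parts function; rows are indexed from `1`. -/
structure Partition (n : ℕ) where
  parts : ℕ → ℕ
  parts_zero : parts 0 = 0
  antitone : ∀ ⦃i j : ℕ⦄, 0 < i → i ≤ j → parts j ≤ parts i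
  finite_support : (Function.support parts).Finite
  sum_parts : ∑ᶠ i, parts i = n

variable {n : ℕ}

/-- The set of cells `(row, column)` (both 1-indexed) of the Young diagram of `μ`. -/
def Partition.cells (μ : Partition n) : Set (ℕ × ℕ) :=
  {c | 0 < c.1 ∧ 0 < c.2 ∧ c.2 ≤ μ.parts c.1}

/-- A tabloid for the composition `c` of `n`: an assignment of the `n` symbols to rows
(rows indexed from 1), row `i` receiving exactly `c i` symbols. -/
def Tabloid (n : ℕ) (c : ℕ → ℕ) : Type :=
  {g : Fin n → ℕ // ∀ i, (Finset.univ.filter fun k => g k = i).card = c i}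

/-- The permutation module `M^c` over `R`: the free `R`-module on the set of tabloids. -/
abbrev PermMod (R : Type*) [CommRing R] (n : ℕ) (c : ℕ → ℕ) := Tabloid n c →₀ R

/-- The action of a permutation of the symbols on tabloids. -/
def permTabloid (c : ℕ → ℕ) (π : Equiv.Perm (Fin n)) (f : Tabloid n c) : Tabloid n c :=
  ⟨fun k => f.1 (π.symm k), fun i => by
    rw [← f.2 i]
    exact Finset.card_equiv π.symm fun a => by simp⟩

/-- The `R`-linear action of a permutation of the symbols on `M^c`. -/
noncomputable def permM (R : Type*) [CommRing R] (c : ℕ → ℕ) (π : Equiv.Perm (Fin n)) :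
    PermMod R n c →ₗ[R] PermMod R n c :=
  Finsupp.lmapDomain R R (permTabloid c π)

/-- A bijective `μ`-tableau, presented by the placement map which sends each of the
`n` symbols to the cell of the Young diagram containing it. -/
structure Placement (μ : Partition n) where
  pos : Fin n → ℕ × ℕ
  mem : ∀ k, pos k ∈ μ.cells
  inj : Function.Injective pos
  surj : ∀ c ∈ μ.cells, ∃ k, pos k = c

/-- The column stabilizer of a bijective tableau, as a set of permutations of the symbols. -/
def colStab {μ : Partition n} (T : Placement μ) : Finset (Equiv.Perm (Fin n)) :=
  Finset.univ.filter fun π => ∀ k, (T.pos (π k)).2 = (T.pos k).2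

lemma rowFiber_card {μ : Partition n} (T : Placement μ) (i : ℕ) :
    (Finset.univ.filter fun k => (T.pos k).1 = i).card = μ.parts i := by
  classical
  have h : (Finset.univ.filter fun k => (T.pos k).1 = i).card
      = (Finset.Icc 1 (μ.parts i)).card := by
    apply Finset.card_bij (fun k _ => (T.pos k).2)
    · intro a ha
      simp only [Finset.mem_filter, Finset.mem_univ, true_and] at ha
      obtain ⟨h1, h2, h3⟩ := T.mem a
      exact Finset.mem_Icc.mpr ⟨h2, ha ▸ h3⟩
    · intro a ha b hb hab
      simp only [Finset.mem_filter, Finset.mem_univ, true_and] at ha hb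
      exact T.inj (Prod.ext (ha.trans hb.symm) hab)
    · intro j hj
      rw [Finset.mem_Icc] at hj
      have hi0 : 0 < i := by
        rcases Nat.eq_zero_or_pos i with h0 | h0
        · exfalso; rw [h0, μ.parts_zero] at hj; omega
        · exact h0
      obtain ⟨k, hk⟩ := T.surj (i, j) ⟨hi0, hj.1, hj.2⟩
      exact ⟨k, by simp [hk], by simp [hk]⟩
  rw [h, Nat.card_Icc]
  omega

/-- The row tabloid `{tπ}` associated to the bijective tableau `tπ`. -/
def rowTabloid {μ : Partition n} (T : Placement μ) (π : Equiv.Perm (Fin n)) :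
    Tabloid n μ.parts :=
  ⟨fun k => (T.pos (π k)).1, fun i => by
    rw [← rowFiber_card T i]
    exact Finset.card_equiv π fun a => by simp⟩

/-- The polytabloid `e_t` attached to a bijective tableau `t`. -/
noncomputable def polytabloid (R : Type*) [CommRing R] {μ : Partition n} (T : Placement μ) :
    PermMod R n μ.parts :=
  ∑ π ∈ colStab T, ((Equiv.Perm.sign π : ℤ) : R) • Finsupp.single (rowTabloid T π) (1 : R)

/-- The Specht module `S^μ`, the span in `M^μ` of all polytabloids. -/
noncomputable def Specht (R : Type*) [CommRing R] (μ : Partition n) :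
    Submodule R (PermMod R n μ.parts) :=
  Submodule.span R (Set.range fun T : Placement μ => polytabloid R T)

/-- `β` is obtained from the partition `α` of `n` by moving one box from
(the end of) row `a` to (the end of) row `b`; i.e. `β` is a one-box-shift of `α`. -/
structure OneBoxShift {n : ℕ} (α β : Partition n) (a b : ℕ) : Prop where
  a_pos : 0 < a
  a_lt_b : a < b
  rem : α.parts (a + 1) < α.parts a
  add : α.parts b < α.parts (b - 1)
  at_a : β.parts a = α.parts a - 1
  at_b : β.parts b = α.parts b + 1
  elsewhere : ∀ i, i ≠ a → i ≠ b → β.parts i = α.parts i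

/-- The equivalence between `Fin m` and the non-maximal elements of `Fin (m+1)`. -/
def castE (m : ℕ) : Fin m ≃ {i : Fin (m + 1) // (i : ℕ) < m} where
  toFun k := ⟨⟨k.1, Nat.lt_succ_of_lt k.2⟩, k.2⟩
  invFun i := ⟨i.1.1, i.2⟩
  left_inv k := rfl
  right_inv i := rfl

/-- The standard embedding `Σ_m ↪ Σ_{m+1}` (as the stabilizer of the last symbol). -/
noncomputable def permIncl (m : ℕ) : Equiv.Perm (Fin m) →* Equiv.Perm (Fin (m + 1)) :=
  Equiv.Perm.extendDomainHom (castE m)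

/-- The induced module `S^λ↑^{Σ_{m+1}}`, realized as the space of functions
`f : Σ_{m+1} → S^λ` with `f(σh) = h⁻¹ · f(σ)` for all `h ∈ Σ_m`; the group `Σ_{m+1}`
acts by left translation: `(g • f)(σ) = f(g⁻¹σ)`. -/
noncomputable def indSpecht (F : Type*) [Field F] {m : ℕ} (lam : Partition m) :
    Submodule F (Equiv.Perm (Fin (m + 1)) → PermMod F m lam.parts) where
  carrier := {f | (∀ σ, f σ ∈ Specht F lam) ∧
    ∀ (σ : Equiv.Perm (Fin (m + 1))) (h : Equiv.Perm (Fin m)),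
      f (σ * permIncl m h) = permM F lam.parts h⁻¹ (f σ)}
  add_mem' := by
    rintro f g ⟨hf1, hf2⟩ ⟨hg1, hg2⟩
    refine ⟨fun σ => (Specht F lam).add_mem (hf1 σ) (hg1 σ), fun σ h => ?_⟩
    simp only [Pi.add_apply, hf2 σ h, hg2 σ h, map_add]
  zero_mem' := ⟨fun _ => (Specht F lam).zero_mem, fun σ h => by simp⟩
  smul_mem' := by
    rintro r f ⟨hf1, hf2⟩
    refine ⟨fun σ => (Specht F lam).smul_mem r (hf1 σ), fun σ h => ?_⟩
    simp only [Pi.smul_apply, hf2 σ h, map_smul]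

/-- The endomorphism algebra `End_{FΣ_{m+1}}(S^λ↑^{Σ_{m+1}})`: the subalgebra of
`F`-endomorphisms intertwining the translation action of `Σ_{m+1}`. -/
noncomputable def EndInd (F : Type*) [Field F] {m : ℕ} (lam : Partition m) :
    Subalgebra F (Module.End F ↥(indSpecht F lam)) where
  carrier := {Φ | ∀ (g : Equiv.Perm (Fin (m + 1))) (x y : ↥(indSpecht F lam)),
    (x : Equiv.Perm (Fin (m + 1)) → PermMod F m lam.parts) = (fun σ => (y : _ → _) (g⁻¹ * σ)) →
    (Φ x : Equiv.Perm (Fin (m + 1)) → PermMod F m lam.parts) = fun σ => (Φ y : _ → _) (g⁻¹ * σ)}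
  mul_mem' := fun {f g} hf hg gg x y hxy => hf gg (g x) (g y) (hg gg x y hxy)
  one_mem' := fun g x y hxy => hxy
  add_mem' := fun {f g} hf hg gg x y hxy => by
    have h1 := hf gg x y hxy
    have h2 := hg gg x y hxy
    funext σ
    simp only [LinearMap.add_apply, Submodule.coe_add, Pi.add_apply]
    rw [congrFun h1 σ, congrFun h2 σ]
  zero_mem' := fun g x y hxy => by
    simp only [LinearMap.zero_apply, Submodule.coe_zero]
    rfl
  algebraMap_mem' := fun c g x y hxy => by
    funext σ
    simp only [Module.algebraMap_end_apply, SetLike.val_smul, Pi.smul_apply]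
    rw [congrFun hxy σ]

/-- The rows of the addable nodes of `[λ]`, `λ` a partition of `m`. -/
def addRows {m : ℕ} (lam : Partition m) : Finset ℕ :=
  (Finset.Icc 1 (m + 1)).filter fun i => i = 1 ∨ lam.parts i < lam.parts (i - 1)

/-- The `p`-residues of the addable nodes of `[λ]`: the addable node in row `i` is
`(i, λ_i + 1)`, of residue `λ_i + 1 - i`. -/
noncomputable def addResSet {m : ℕ} (lam : Partition m) (p : ℕ) : Finset (ZMod p) :=
  (addRows lam).image fun i => (((lam.parts i : ℤ) + 1 - (i : ℤ) : ℤ) : ZMod p)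

/-- The number of addable nodes of `[λ]` of `p`-residue `r`. -/
noncomputable def addResCount {m : ℕ} (lam : Partition m) (p : ℕ) (r : ZMod p) : ℕ :=
  ((addRows lam).filter fun i => (((lam.parts i : ℤ) + 1 - (i : ℤ) : ℤ) : ZMod p) = r).card

end CarterPayne

namespace CarterPayne
open Finset

/-! ### Coefficients of elements of permutation modules -/

open Classical in
/-- The coefficient functional at the row function `g` (zero if `g` is not a tabloid). -/
noncomputable def coef (F : Type*) [Field F] {m : ℕ} (c : ℕ → ℕ) (g : Fin m → ℕ) :
    PermMod F m c →ₗ[F] F :=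
  if h : ∀ i, (Finset.univ.filter fun k => g k = i).card = c i then
    Finsupp.lapply (⟨g, h⟩ : Tabloid m c) else 0

section coefs
variable {F : Type*} [Field F] {m : ℕ} {c : ℕ → ℕ}

lemma coef_tab (x : Tabloid m c) (y : PermMod F m c) : coef F c x.1 y = y x := by
  unfold coef
  rw [dif_pos x.2]; rfl

/-- The tabloid with a given row function. -/
def mkTab {g : Fin m → ℕ} (hg : ∀ i, (Finset.univ.filter fun k => g k = i).card = c i) :
    Tabloid m c := ⟨g, hg⟩

lemma coef_mk {g : Fin m → ℕ} (hg : ∀ i, (Finset.univ.filter fun k => g k = i).card = c i)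
    (y : PermMod F m c) : coef F c g y = y (mkTab hg) := by
  unfold coef
  rw [dif_pos hg]; rfl

lemma coef_sizes {g : Fin m → ℕ} {y : PermMod F m c} (h : coef F c g y ≠ 0) :
    ∀ i, (Finset.univ.filter fun k => g k = i).card = c i := by
  by_contra hc
  apply h
  unfold coef
  rw [dif_neg hc]; rfl

lemma coef_ext {y z : PermMod F m c} (h : ∀ g, coef F c g y = coef F c g z) : y = z := by
  ext x
  rw [← coef_tab, ← coef_tab, h]

lemma permTabloid_injective (π : Equiv.Perm (Fin m)) :
    Function.Injective (permTabloid c π) := by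
  intro a b hab
  apply Subtype.ext
  funext k
  have := congrFun (congrArg Subtype.val hab) (π k)
  simpa [permTabloid] using this

lemma coef_permM (h : Equiv.Perm (Fin m)) (y : PermMod F m c) (g : Fin m → ℕ) :
    coef F c g (permM F c h y) = coef F c (g ∘ h) y := by
  by_cases hg : ∀ i, (Finset.univ.filter fun k => g k = i).card = c i
  · have hg' : ∀ i, (Finset.univ.filter fun k => (g ∘ h) k = i).card = c i := by
      intro i
      rw [← hg i]
      exact Finset.card_equiv h fun a => by simp
    have e1 : (mkTab hg : Tabloid m c) = permTabloid c h (mkTab hg') := by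
      apply Subtype.ext
      funext k
      simp [permTabloid, mkTab]
    rw [coef_mk hg, coef_mk hg', e1]
    exact Finsupp.mapDomain_apply (permTabloid_injective h) y _
  · have hg' : ¬ ∀ i, (Finset.univ.filter fun k => (g ∘ h) k = i).card = c i := by
      intro h2
      apply hg
      intro i
      rw [← h2 i]
      exact (Finset.card_equiv h fun a => by simp).symm
    unfold coef
    rw [dif_neg hg, dif_neg hg']; rfl

lemma permM_mul (a b : Equiv.Perm (Fin m)) (y : PermMod F m c) :
    permM F c (a * b) y = permM F c a (permM F c b y) := by
  apply coef_ext
  intro g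
  simp only [coef_permM]
  rfl

lemma permM_one (y : PermMod F m c) :
    permM F c (1 : Equiv.Perm (Fin m)) y = y := by
  apply coef_ext
  intro g
  simp only [coef_permM]
  rfl

end coefs

section poly
variable {F : Type*} [Field F] {m : ℕ} {lam : Partition m} (T : Placement lam)

open Classical in
lemma coef_poly (g : Fin m → ℕ) : coef F lam.parts g (polytabloid F T) =
    ∑ π ∈ colStab T, ((Equiv.Perm.sign π : ℤ) : F) *
      (if g = (fun k => (T.pos (π k)).1) then 1 else 0) := by
  unfold polytabloid
  rw [map_sum]
  apply Finset.sum_congr rfl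
  intro π _
  rw [map_smul, smul_eq_mul]
  congr 1
  by_cases hg : ∀ i, (Finset.univ.filter fun k => g k = i).card = lam.parts i
  · rw [coef_mk hg, Finsupp.single_apply]
    congr 1
    rw [eq_iff_iff]
    constructor
    · intro h; exact (congrArg Subtype.val h).symm
    · intro h; apply Subtype.ext; exact h.symm
  · unfold coef
    rw [dif_neg hg, if_neg]
    · rfl
    · intro h
      apply hg
      rw [h]
      exact (rowTabloid T π).2

lemma mem_colStab {π : Equiv.Perm (Fin m)} :
    π ∈ colStab T ↔ ∀ k, (T.pos (π k)).2 = (T.pos k).2 := by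
  simp [colStab]

lemma poly_supp {g : Fin m → ℕ} (h : coef F lam.parts g (polytabloid F T) ≠ 0) :
    ∃ π ∈ colStab T, g = fun k => (T.pos (π k)).1 := by
  classical
  rw [coef_poly] at h
  obtain ⟨π, hπ, h1⟩ := Finset.exists_ne_zero_of_sum_ne_zero h
  refine ⟨π, hπ, ?_⟩
  by_contra hc
  rw [if_neg hc] at h1
  simp at h1

lemma poly_anti {y z : Fin m} (hyz : y ≠ z) (hc : (T.pos y).2 = (T.pos z).2) (g : Fin m → ℕ) :
    coef F lam.parts (g ∘ Equiv.swap y z) (polytabloid F T) =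
      - coef F lam.parts g (polytabloid F T) := by
  classical
  rw [coef_poly, coef_poly, ← Finset.sum_neg_distrib]
  have hsw : ∀ k, (T.pos (Equiv.swap y z k)).2 = (T.pos k).2 := by
    intro k
    rw [Equiv.swap_apply_def]
    split_ifs with h1 h2
    · rw [h1, hc]
    · rw [h2, hc]
    · rfl
  refine Finset.sum_bij' (fun π _ => π * Equiv.swap y z) (fun π _ => π * Equiv.swap y z)
    ?_ ?_ ?_ ?_ ?_
  · intro π hπ
    rw [mem_colStab] at hπ ⊢
    intro k
    rw [Equiv.Perm.mul_apply, hπ, hsw]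
  · intro π hπ
    rw [mem_colStab] at hπ ⊢
    intro k
    rw [Equiv.Perm.mul_apply, hπ, hsw]
  · intro π _
    simp [mul_assoc]
  · intro π _
    simp [mul_assoc]
  · intro π _
    have : (g ∘ Equiv.swap y z = fun k => (T.pos (π k)).1) ↔
      (g = fun k => (T.pos ((π * Equiv.swap y z) k)).1) := by
      constructor
      · intro h
        funext k
        have := congrFun h (Equiv.swap y z k)
        simpa using this
      · intro h
        funext k
        have := congrFun h (Equiv.swap y z k)
        simpa using this
    simp only [this, map_mul, Equiv.Perm.sign_swap hyz]
    simp

lemma poly_conf {y z : Fin m} (hyz : y ≠ z) (hc : (T.pos y).2 = (T.pos z).2) {g : Fin m → ℕ}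
    (hg : g y = g z) : coef F lam.parts g (polytabloid F T) = 0 := by
  by_contra h
  obtain ⟨π, hπ, rfl⟩ := poly_supp T h
  rw [mem_colStab] at hπ
  apply hyz
  apply π.injective
  apply T.inj
  apply Prod.ext
  · exact hg
  · rw [hπ, hπ, hc]

lemma poly_in {g : Fin m → ℕ} (h : coef F lam.parts g (polytabloid F T) ≠ 0) (k : Fin m) :
    (g k, (T.pos k).2) ∈ lam.cells := by
  obtain ⟨π, hπ, rfl⟩ := poly_supp T h
  rw [mem_colStab] at hπ
  have := T.mem (π k)
  rw [← hπ k]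
  exact this

lemma poly_onto {g : Fin m → ℕ} (h : coef F lam.parts g (polytabloid F T) ≠ 0) {a c : ℕ}
    (hac : (a, c) ∈ lam.cells) : ∃ z, (T.pos z).2 = c ∧ g z = a := by
  obtain ⟨π, hπ, rfl⟩ := poly_supp T h
  rw [mem_colStab] at hπ
  obtain ⟨w, hw⟩ := T.surj _ hac
  refine ⟨π.symm w, ?_, ?_⟩
  · rw [← hπ]; simp [hw]
  · simp [hw]

/-- Garnir relation with one element of column `d`. -/
lemma poly_garnir {x : Fin m} {c : ℕ} (hxc : (T.pos x).2 ≠ c)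
    (hlen : ∀ a, (a, (T.pos x).2) ∈ lam.cells → (a, c) ∈ lam.cells) (s : Fin m → ℕ) :
    ∑ y ∈ Finset.univ.filter (fun y => (T.pos y).2 = c),
      coef F lam.parts (s ∘ Equiv.swap y x) (polytabloid F T) =
      coef F lam.parts s (polytabloid F T) := by
  classical
  have hne : ∀ y, (T.pos y).2 = c → y ≠ x := by
    rintro y hy rfl; exact hxc hy
  by_cases hs : coef F lam.parts s (polytabloid F T) = 0
  · rw [hs]
    by_contra hsum
    obtain ⟨y1, hy1, h1⟩ := Finset.exists_ne_zero_of_sum_ne_zero hsum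
    simp only [Finset.mem_filter, Finset.mem_univ, true_and] at hy1
    obtain ⟨z, hz, hz2⟩ := poly_onto T h1 (hlen _ (poly_in T h1 x))
    have hzx := hne z hz
    have hy1x := hne y1 hy1
    simp only [Function.comp_apply, Equiv.swap_apply_right] at hz2
    have hzy : z ≠ y1 := by
      rintro rfl
      apply h1
      rw [← hs]
      congr 1
      have : s ∘ Equiv.swap z x = s := by
        rw [Equiv.swap_apply_left] at hz2
        funext k
        simp only [Function.comp_apply, Equiv.swap_apply_def]
        split_ifs with h1 h2
        · rw [h1, hz2]
        · rw [h2, hz2]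
        · rfl
      rw [this]
    rw [Equiv.swap_apply_of_ne_of_ne hzy hzx] at hz2
    apply hsum
    rw [← Finset.sum_subset (s₁ := {y1, z})]
    · rw [Finset.sum_pair hzy.symm]
      have : s ∘ Equiv.swap z x = (s ∘ Equiv.swap y1 x) ∘ Equiv.swap y1 z := by
        funext k
        simp only [Function.comp_apply, Equiv.swap_apply_def]
        split_ifs <;> simp_all
      rw [this, poly_anti T hzy.symm (by rw [hy1, hz])]
      ring
    · intro k
      simp only [Finset.mem_insert, Finset.mem_singleton, Finset.mem_filter, Finset.mem_univ,
        true_and]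
      rintro (rfl | rfl) <;> assumption
    · intro k hk hk2
      simp only [Finset.mem_insert, Finset.mem_singleton, Finset.mem_filter, Finset.mem_univ,
        true_and, not_or] at hk hk2
      apply poly_conf T hzy (by rw [hz, hy1])
      simp only [Function.comp_apply]
      rw [Equiv.swap_apply_of_ne_of_ne (Ne.symm hk2.2) hzx,
        Equiv.swap_apply_of_ne_of_ne (Ne.symm hk2.1) hy1x, hz2]
  · obtain ⟨y0, hy0, h0⟩ := poly_onto T hs (hlen _ (poly_in T hs x))
    rw [Finset.sum_eq_single y0]
    · congr 1
      have : s ∘ Equiv.swap y0 x = s := by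
        funext k
        simp only [Function.comp_apply, Equiv.swap_apply_def]
        split_ifs with h1 h2
        · rw [h1, h0]
        · rw [h2, h0]
        · rfl
      rw [this]
    · intro y hy hyy
      simp only [Finset.mem_filter, Finset.mem_univ, true_and] at hy
      apply poly_conf T hyy (by rw [hy, hy0])
      simp only [Function.comp_apply, Equiv.swap_apply_left]
      rw [Equiv.swap_apply_of_ne_of_ne hyy.symm (hne _ hy0), h0]
    · intro h
      simp [hy0] at h

lemma cells_up {a b c : ℕ} (ha : 0 < a) (hab : a ≤ b) (h : (b, c) ∈ lam.cells) :
    (a, c) ∈ lam.cells :=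
  ⟨ha, h.2.1, h.2.2.trans (lam.antitone ha hab)⟩

/-- Row relation for polytabloids. -/
lemma poly_row {a b : ℕ} (ha : 0 < a) (hab : a < b) (s : Fin m → ℕ) :
    ∑ k ∈ Finset.univ.filter (fun k => s k = a),
      coef F lam.parts (Function.update s k b) (polytabloid F T) = 0 := by
  classical
  by_contra hsum
  obtain ⟨k1, hk1, h1⟩ := Finset.exists_ne_zero_of_sum_ne_zero hsum
  simp only [Finset.mem_filter, Finset.mem_univ, true_and] at hk1
  have hb := poly_in T h1 k1
  rw [Function.update_self] at hb
  obtain ⟨z, hz, hz2⟩ := poly_onto T h1 (cells_up ha hab.le hb)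
  have hzk : z ≠ k1 := by
    rintro rfl
    rw [Function.update_self] at hz2
    omega
  rw [Function.update_of_ne hzk] at hz2
  apply hsum
  rw [← Finset.sum_subset (s₁ := {k1, z})]
  · rw [Finset.sum_pair hzk.symm]
    have : Function.update s z b = (Function.update s k1 b) ∘ Equiv.swap k1 z := by
      funext k
      simp only [Function.comp_apply, Equiv.swap_apply_def, Function.update_apply]
      split_ifs <;> simp_all
    rw [this, poly_anti T hzk.symm hz.symm]
    ring
  · intro k
    simp only [Finset.mem_insert, Finset.mem_singleton, Finset.mem_filter, Finset.mem_univ,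
      true_and]
    rintro (rfl | rfl) <;> assumption
  · intro k hk hk2
    simp only [Finset.mem_insert, Finset.mem_singleton, Finset.mem_filter, Finset.mem_univ,
      true_and, not_or] at hk hk2
    apply poly_conf T hzk hz
    rw [Function.update_of_ne (Ne.symm hk2.2), Function.update_of_ne (Ne.symm hk2.1), hz2, hk1]

lemma specht_row {y : PermMod F m lam.parts} (hy : y ∈ Specht F lam) {a b : ℕ} (ha : 0 < a)
    (hab : a < b) (s : Fin m → ℕ) :
    ∑ k ∈ Finset.univ.filter (fun k => s k = a),
      coef F lam.parts (Function.update s k b) y = 0 := by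
  unfold Specht at hy
  induction hy using Submodule.span_induction with
  | mem x h => obtain ⟨T, rfl⟩ := h; exact poly_row T ha hab s
  | zero => simp
  | add x y _ _ h1 h2 => simp only [map_add, Finset.sum_add_distrib, h1, h2, add_zero]
  | smul r x _ h => simp only [map_smul, ← Finset.smul_sum, h, smul_zero]

/-- The tableau moved by a permutation. -/
def Placement.move (T : Placement lam) (h : Equiv.Perm (Fin m)) : Placement lam where
  pos k := T.pos (h.symm k)
  mem k := T.mem _
  inj := T.inj.comp h.symm.injective
  surj c hc := by
    obtain ⟨k, hk⟩ := T.surj c hc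
    exact ⟨h k, by simpa using hk⟩

lemma permM_poly (h : Equiv.Perm (Fin m)) :
    permM F lam.parts h (polytabloid F T) = polytabloid F (T.move h) := by
  classical
  apply coef_ext
  intro g
  rw [coef_permM, coef_poly, coef_poly]
  refine Finset.sum_bij' (fun π _ => h * π * h⁻¹) (fun π _ => h⁻¹ * π * h) ?_ ?_ ?_ ?_ ?_
  · intro π hπ
    rw [mem_colStab] at hπ ⊢
    intro k
    have := hπ (h.symm k)
    simpa [Placement.move] using this
  · intro π hπ
    rw [mem_colStab] at hπ ⊢
    intro k
    have := hπ (h k)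
    simpa [Placement.move] using this
  · intro π _
    group
  · intro π _
    group
  · intro π _
    have : (g ∘ h = fun k => (T.pos (π k)).1) ↔
      (g = fun k => ((T.move h).pos ((h * π * h⁻¹) k)).1) := by
      constructor
      · intro h2
        funext k
        have := congrFun h2 (h.symm k)
        simpa [Placement.move] using this
      · intro h2
        funext k
        have := congrFun h2 (h k)
        simpa [Placement.move] using this
    have hs : Equiv.Perm.sign (h * π * h⁻¹) = Equiv.Perm.sign π := by
      rw [map_mul, map_mul, map_inv, mul_comm, inv_mul_cancel_left]
    rw [hs]
    simp only [this]

lemma permM_specht (h : Equiv.Perm (Fin m)) {y : PermMod F m lam.parts} (hy : y ∈ Specht F lam) :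
    permM F lam.parts h y ∈ Specht F lam := by
  unfold Specht at hy
  induction hy using Submodule.span_induction with
  | mem x h => obtain ⟨T, rfl⟩ := h; simp only [permM_poly]; exact Submodule.subset_span ⟨_, rfl⟩
  | zero => simp
  | add x y _ _ h1 h2 => rw [map_add]; exact Submodule.add_mem _ h1 h2
  | smul r x _ h => rw [map_smul]; exact Submodule.smul_mem _ _ h

lemma exists_move (T' : Placement lam) : ∃ h, T' = T.move h := by
  choose f hf using fun k => T.surj _ (T'.mem k)
  have hinj : Function.Injective f := by
    intro a b hab
    apply T'.inj
    rw [← hf, ← hf, hab]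
  have hbij := Finite.injective_iff_bijective.1 hinj
  refine ⟨(Equiv.ofBijective f hbij).symm, ?_⟩
  cases T'
  simp only [Placement.move, Placement.mk.injEq, Equiv.symm_symm, Equiv.ofBijective_apply]
  funext k
  exact (hf k).symm

end poly

section exist

lemma parts_support {m : ℕ} (lam : Partition m) : ∃ N, ∀ i, N < i → lam.parts i = 0 := by
  obtain ⟨N, hN⟩ := lam.finite_support.bddAbove
  refine ⟨N, fun i hi => ?_⟩
  by_contra h
  have := hN (show i ∈ Function.support lam.parts from h)
  omega

lemma exists_placement {m : ℕ} (lam : Partition m) : Nonempty (Placement lam) := by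
  classical
  let S : Finset (ℕ × ℕ) := (lam.finite_support.toFinset).biUnion
    fun i => (Finset.Icc 1 (lam.parts i)).image fun j => (i, j)
  have hS : ∀ c, c ∈ S ↔ c ∈ lam.cells := by
    rintro ⟨i, j⟩
    simp only [S, Finset.mem_biUnion, Set.Finite.mem_toFinset, Function.mem_support,
      Finset.mem_image, Finset.mem_Icc, Prod.mk.injEq, Partition.cells, Set.mem_ofPred_eq]
    constructor
    · rintro ⟨a, ha, b, hb, rfl, rfl⟩
      refine ⟨?_, by omega, by omega⟩
      rcases Nat.eq_zero_or_pos a with h | h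
      · rw [h, lam.parts_zero] at ha; omega
      · exact h
    · rintro ⟨h1, h2, h3⟩
      exact ⟨i, by omega, j, ⟨h2, h3⟩, rfl, rfl⟩
  have hcard : S.card = m := by
    rw [Finset.card_biUnion]
    · rw [Finset.sum_congr rfl (g := lam.parts)]
      · exact (finsum_eq_sum _ lam.finite_support).symm.trans lam.sum_parts
      · intro i _
        rw [Finset.card_image_of_injective _ (by intro a b h; simpa using h)]
        simp
    · intro i _ j _ hij
      rw [Function.onFun, Finset.disjoint_left]
      rintro ⟨a, b⟩ h1 h2
      simp only [Finset.mem_image, Prod.mk.injEq] at h1 h2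
      obtain ⟨_, _, rfl, _⟩ := h1
      obtain ⟨_, _, rfl, _⟩ := h2
      exact hij rfl
  let e := (Finset.equivFinOfCardEq hcard).symm
  refine ⟨⟨fun k => (e k).1, fun k => (hS _).1 (e k).2, ?_, ?_⟩⟩
  · intro a b h
    exact e.injective (Subtype.ext h)
  · intro c hc
    exact ⟨e.symm ⟨c, (hS c).2 hc⟩, by simp⟩

end exist
end CarterPayne

namespace CarterPayne
open Finset

section ind
variable {F : Type*} [Field F] {m : ℕ} {lam : Partition m}

lemma permIncl_cs (h : Equiv.Perm (Fin m)) (k : Fin m) :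
    permIncl m h (Fin.castSucc k) = Fin.castSucc (h k) :=
  Equiv.Perm.extendDomain_apply_image h (castE m) k

lemma permIncl_last (h : Equiv.Perm (Fin m)) : permIncl m h (Fin.last m) = Fin.last m :=
  Equiv.Perm.extendDomain_apply_not_subtype h (castE m) (by simp)

lemma permIncl_inj : Function.Injective (permIncl m) :=
  Equiv.Perm.extendDomainHom_injective _

lemma exists_permIncl {σ : Equiv.Perm (Fin (m + 1))} (hσ : σ (Fin.last m) = Fin.last m) :
    ∃ h, permIncl m h = σ := by
  have h1 : ∀ k : Fin m, ∃ l : Fin m, Fin.castSucc l = σ (Fin.castSucc k) := by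
    intro k
    apply Fin.exists_castSucc_eq.2
    intro h
    have := σ.injective (h.trans hσ.symm)
    exact Fin.castSucc_ne_last k this
  choose f hf using h1
  have hinj : Function.Injective f := by
    intro a b hab
    have := congrArg Fin.castSucc hab
    rw [hf, hf] at this
    exact Fin.castSucc_injective _ (σ.injective this)
  have hbij := Finite.injective_iff_bijective.1 hinj
  refine ⟨Equiv.ofBijective f hbij, ?_⟩
  ext k
  refine Fin.lastCases ?_ (fun k => ?_) k
  · rw [permIncl_last, hσ]
  · rw [permIncl_cs, Equiv.ofBijective_apply, hf]

/-- The matrix coefficient of an element of the induced module: the symbol in row `0` is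
the marked one. -/
noncomputable def vv (f : ↥(indSpecht F lam)) (s : Fin (m + 1) → ℕ) : F :=
  ∑ k, if s k = 0 then
    coef F lam.parts (s ∘ Equiv.swap k (Fin.last m) ∘ Fin.castSucc)
      (f.1 (Equiv.swap k (Fin.last m))) else 0

lemma coef_two {s : Fin (m + 1) → ℕ} {k : Fin (m + 1)} {σ : Equiv.Perm (Fin (m + 1))}
    (hk : s k = 0) (hσ : σ (Fin.last m) ≠ k) (y : PermMod F m lam.parts) :
    coef F lam.parts (s ∘ σ ∘ Fin.castSucc) y = 0 := by
  by_contra h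
  have := coef_sizes h 0
  rw [lam.parts_zero, Finset.card_eq_zero] at this
  obtain ⟨l, hl⟩ := Fin.exists_castSucc_eq.2 (show σ.symm k ≠ Fin.last m by
    intro h; apply hσ; rw [← h]; simp)
  have h2 : l ∈ Finset.univ.filter fun k => (s ∘ σ ∘ Fin.castSucc) k = 0 := by
    simp [hl, hk]
  rw [this] at h2
  simp at h2

lemma vv_eq (f : ↥(indSpecht F lam)) {s : Fin (m + 1) → ℕ} (σ : Equiv.Perm (Fin (m + 1)))
    (hs : s (σ (Fin.last m)) = 0) :
    vv f s = coef F lam.parts (s ∘ σ ∘ Fin.castSucc) (f.1 σ) := by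
  unfold vv
  rw [Finset.sum_eq_single (σ (Fin.last m))]
  · rw [if_pos hs]
    obtain ⟨h, hh⟩ := exists_permIncl (σ := Equiv.swap (σ (Fin.last m)) (Fin.last m) * σ)
      (by simp)
    have h1 : σ = Equiv.swap (σ (Fin.last m)) (Fin.last m) * permIncl m h := by
      rw [hh, ← mul_assoc, Equiv.swap_mul_self, one_mul]
    have h2 : f.1 σ = permM F lam.parts h⁻¹
        (f.1 (Equiv.swap (σ (Fin.last m)) (Fin.last m))) := by
      conv_lhs => rw [h1]
      exact f.2.2 _ _
    rw [h2, coef_permM]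
    congr 1
    congr 1
    funext k
    simp only [Function.comp_apply]
    conv_rhs => rw [h1]
    rw [Equiv.Perm.mul_apply, permIncl_cs]
    simp
  · intro k _ hk
    split_ifs with h
    · exact coef_two hs (by simpa using hk) _
    · rfl
  · simp

lemma vv_none (f : ↥(indSpecht F lam)) {s : Fin (m + 1) → ℕ} (hs : ∀ k, s k ≠ 0) :
    vv f s = 0 := by
  unfold vv
  exact Finset.sum_eq_zero fun k _ => if_neg (hs k)

lemma vv_two (f : ↥(indSpecht F lam)) {s : Fin (m + 1) → ℕ} {a b : Fin (m + 1)} (hab : a ≠ b)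
    (ha : s a = 0) (hb : s b = 0) : vv f s = 0 := by
  rw [vv_eq f (Equiv.swap a (Fin.last m)) (by simpa using ha)]
  exact coef_two hb (by simpa using hab) _

lemma vv_zero (s : Fin (m + 1) → ℕ) : vv (0 : ↥(indSpecht F lam)) s = 0 := by
  unfold vv; simp

lemma vv_add (f g : ↥(indSpecht F lam)) (s : Fin (m + 1) → ℕ) :
    vv (f + g) s = vv f s + vv g s := by
  unfold vv
  rw [← Finset.sum_add_distrib]
  apply Finset.sum_congr rfl
  intro k _
  split_ifs
  · simp
  · simp

lemma vv_smul (r : F) (f : ↥(indSpecht F lam)) (s : Fin (m + 1) → ℕ) :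
    vv (r • f) s = r * vv f s := by
  unfold vv
  rw [Finset.mul_sum]
  apply Finset.sum_congr rfl
  intro k _
  split_ifs
  · simp
  · simp

variable (F lam) in
/-- `vv` as a linear map. -/
noncomputable def vvL (s : Fin (m + 1) → ℕ) : ↥(indSpecht F lam) →ₗ[F] F where
  toFun f := vv f s
  map_add' f g := vv_add f g s
  map_smul' r f := vv_smul r f s

lemma vv_sum {ι : Type*} (t : Finset ι) (f : ι → ↥(indSpecht F lam)) (s : Fin (m + 1) → ℕ) :
    vv (∑ i ∈ t, f i) s = ∑ i ∈ t, vv (f i) s := map_sum (vvL F lam s) f t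

lemma vv_neg (f : ↥(indSpecht F lam)) (s : Fin (m + 1) → ℕ) :
    vv (-f) s = - vv f s := map_neg (vvL F lam s) f

lemma vv_ext {f g : ↥(indSpecht F lam)} (h : ∀ s, vv f s = vv g s) : f = g := by
  apply Subtype.ext
  funext σ
  apply coef_ext
  intro t
  have h0 := h ((Fin.snoc (α := fun _ => ℕ) t 0) ∘ σ.symm)
  rw [vv_eq f σ (by simp), vv_eq g σ (by simp)] at h0
  have h1 : ((Fin.snoc (α := fun _ => ℕ) t 0) ∘ σ.symm) ∘ σ ∘ Fin.castSucc = t := by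
    funext k
    simp
  rwa [h1] at h0

lemma card_filter_cs (s : Fin (m + 1) → ℕ) (i : ℕ) :
    (Finset.univ.filter fun z => s z = i).card =
      (Finset.univ.filter fun k : Fin m => s (Fin.castSucc k) = i).card +
      (if s (Fin.last m) = i then 1 else 0) := by
  rw [Finset.card_filter, Fin.sum_univ_castSucc, Finset.card_filter]

lemma vv_sizes {f : ↥(indSpecht F lam)} {s : Fin (m + 1) → ℕ} (h : vv f s ≠ 0) (i : ℕ) :
    (Finset.univ.filter fun z => s z = i).card = if i = 0 then 1 else lam.parts i := by
  have hk : ∃ k, s k = 0 := by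
    by_contra hc
    push Not at hc
    exact h (vv_none f hc)
  obtain ⟨k, hk⟩ := hk
  rw [vv_eq f (Equiv.swap k (Fin.last m)) (by simpa using hk)] at h
  have h1 := coef_sizes h i
  have h2 : (Finset.univ.filter fun z => s z = i).card =
      (Finset.univ.filter fun z => (s ∘ Equiv.swap k (Fin.last m)) z = i).card := by
    refine Finset.card_equiv (Equiv.swap k (Fin.last m)) fun a => ?_
    simp
  rw [h2, card_filter_cs]
  simp only [Function.comp_apply, Equiv.swap_apply_right, hk] at h1 ⊢
  rw [h1]
  split_ifs with h3 h4 h5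
  · rw [← h3, lam.parts_zero]
  · omega
  · omega
  · rfl

lemma vv_row (f : ↥(indSpecht F lam)) {a b : ℕ} (ha : 0 < a) (hab : a < b)
    (s : Fin (m + 1) → ℕ) :
    ∑ k ∈ Finset.univ.filter (fun k => s k = a), vv f (Function.update s k b) = 0 := by
  by_cases hk : ∃ k, s k = 0
  · obtain ⟨k0, hk0⟩ := hk
    have key := specht_row (f.2.1 (Equiv.swap k0 (Fin.last m))) ha hab
      (s ∘ Equiv.swap k0 (Fin.last m) ∘ Fin.castSucc)
    rw [← key]
    symm
    refine Finset.sum_bij (fun k _ => Equiv.swap k0 (Fin.last m) (Fin.castSucc k)) ?_ ?_ ?_ ?_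
    · intro k hk
      simpa using hk
    · intro k _ l _ hkl
      exact Fin.castSucc_injective _ (Equiv.injective _ hkl)
    · intro z hz
      simp only [Finset.mem_filter, Finset.mem_univ, true_and] at hz
      obtain ⟨l, hl⟩ := Fin.exists_castSucc_eq.2
        (show (Equiv.swap k0 (Fin.last m)).symm z ≠ Fin.last m by
          intro h
          have : z = k0 := by
            rw [Equiv.symm_apply_eq] at h
            rw [h]; simp
          rw [this] at hz
          omega)
      rw [Equiv.eq_symm_apply] at hl
      refine ⟨l, ?_, hl⟩
      simp [hl, hz]
    · intro k hk
      simp only [Finset.mem_filter, Finset.mem_univ, true_and, Function.comp_apply] at hk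
      have hne : k0 ≠ Equiv.swap k0 (Fin.last m) (Fin.castSucc k) := by
        intro h
        rw [← h] at hk
        omega
      rw [vv_eq f (Equiv.swap k0 (Fin.last m))]
      · congr 1
        congr 1
        funext l
        simp only [Function.comp_apply, Function.update_apply, EmbeddingLike.apply_eq_iff_eq,
          Fin.castSucc_inj]
      · rw [Equiv.swap_apply_right, Function.update_of_ne hne, hk0]
  · push Not at hk
    apply Finset.sum_eq_zero
    intro k _
    apply vv_none
    intro l
    rw [Function.update_apply]
    split_ifs
    · omega
    · exact hk l

/-- The translation action. -/
noncomputable def act (g : Equiv.Perm (Fin (m + 1))) : Module.End F ↥(indSpecht F lam) where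
  toFun f := ⟨fun σ => f.1 (g⁻¹ * σ), fun σ => f.2.1 _, fun σ h => by
    change f.1 (g⁻¹ * (σ * permIncl m h)) = _
    rw [← mul_assoc]; exact f.2.2 _ _⟩
  map_add' f g := rfl
  map_smul' r f := rfl

lemma act_apply (g : Equiv.Perm (Fin (m + 1))) (f : ↥(indSpecht F lam)) (σ) :
    (act g f).1 σ = f.1 (g⁻¹ * σ) := rfl

lemma vv_act (g : Equiv.Perm (Fin (m + 1))) (f : ↥(indSpecht F lam)) (s : Fin (m + 1) → ℕ) :
    vv (act g f) s = vv f (s ∘ g) := by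
  by_cases hk : ∃ k, s k = 0
  · obtain ⟨k0, hk0⟩ := hk
    rw [vv_eq _ (Equiv.swap k0 (Fin.last m)) (by simpa using hk0),
      vv_eq _ (g⁻¹ * Equiv.swap k0 (Fin.last m)) (by simpa using hk0), act_apply]
    congr 1
    congr 1
    funext l
    simp
  · push Not at hk
    rw [vv_none _ hk, vv_none]
    intro k
    exact hk _

variable (F lam) in
/-- The translation action as a monoid homomorphism. -/
noncomputable def actHom : Equiv.Perm (Fin (m + 1)) →* Module.End F ↥(indSpecht F lam) where
  toFun := act
  map_one' := by
    apply LinearMap.ext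
    intro f
    apply vv_ext
    intro s
    rw [vv_act]
    rfl
  map_mul' g h := by
    apply LinearMap.ext
    intro f
    apply vv_ext
    intro s
    rw [vv_act, Module.End.mul_apply, vv_act, vv_act]
    rfl

lemma mem_EndInd {Φ : Module.End F ↥(indSpecht F lam)} :
    Φ ∈ EndInd F lam ↔ ∀ g f, Φ (act g f) = act g (Φ f) := by
  constructor
  · intro h g f
    apply Subtype.ext
    exact h g (act g f) f rfl
  · intro h g x y hxy
    have : x = act g y := Subtype.ext hxy
    rw [this, h]
    rfl

/-- The inclusion of the Specht module. -/
noncomputable def iota : ↥(Specht F lam) →ₗ[F] ↥(indSpecht F lam) where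
  toFun y := ⟨fun σ => ∑ h, if permIncl m h = σ then permM F lam.parts h⁻¹ y.1 else 0,
    fun σ => by
      apply Submodule.sum_mem
      intro h _
      split_ifs
      · exact permM_specht _ y.2
      · exact Submodule.zero_mem _,
    fun σ h => by
      rw [map_sum]
      refine (Fintype.sum_equiv (Equiv.mulRight h) _ _ ?_).symm
      intro k
      simp only [Equiv.coe_mulRight, map_mul, mul_left_inj, mul_inv_rev, permM_mul]
      split_ifs <;> simp⟩
  map_add' y z := by
    apply Subtype.ext
    funext σ
    simp only [Submodule.coe_add, map_add, Pi.add_apply, ← Finset.sum_add_distrib]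
    apply Finset.sum_congr rfl
    intro h _
    split_ifs <;> simp
  map_smul' r y := by
    apply Subtype.ext
    funext σ
    simp only [SetLike.val_smul, map_smul, Pi.smul_apply, Finset.smul_sum, RingHom.id_apply]
    apply Finset.sum_congr rfl
    intro h _
    split_ifs <;> simp

lemma iota_one (y : ↥(Specht F lam)) : (iota y).1 1 = y.1 := by
  change (∑ h, if permIncl m h = 1 then permM F lam.parts h⁻¹ y.1 else 0) = y.1
  rw [Finset.sum_eq_single 1]
  · rw [map_one, if_pos rfl, inv_one, permM_one]
  · intro h _ hh
    rw [if_neg]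
    intro h2
    apply hh
    apply permIncl_inj
    rw [h2, map_one]
  · simp

lemma iota_ne (y : ↥(Specht F lam)) {σ : Equiv.Perm (Fin (m + 1))}
    (hσ : σ (Fin.last m) ≠ Fin.last m) : (iota y).1 σ = 0 := by
  apply Finset.sum_eq_zero
  intro h _
  apply if_neg
  rintro rfl
  exact hσ (permIncl_last h)

lemma vv_iota (y : ↥(Specht F lam)) (s : Fin (m + 1) → ℕ) :
    vv (iota y) s = if s (Fin.last m) = 0 then coef F lam.parts (s ∘ Fin.castSucc) y.1 else 0 := by
  split_ifs with h
  · rw [vv_eq _ 1 h, iota_one]; rfl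
  · by_cases hk : ∃ k, s k = 0
    · obtain ⟨k0, hk0⟩ := hk
      rw [vv_eq _ (Equiv.swap k0 (Fin.last m)) (by simpa using hk0), iota_ne, map_zero]
      rw [Equiv.swap_apply_right]
      rintro rfl
      exact h hk0
    · push Not at hk
      exact vv_none _ hk

lemma iota_perm (h : Equiv.Perm (Fin m)) (y : ↥(Specht F lam)) :
    iota ⟨permM F lam.parts h y.1, permM_specht h y.2⟩ = act (permIncl m h) (iota y) := by
  apply vv_ext
  intro s
  rw [vv_act, vv_iota, vv_iota]
  simp only [coef_permM, Function.comp_apply, permIncl_last]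
  congr 2
  congr 1
  funext k
  simp [permIncl_cs]

lemma ind_expand (f : ↥(indSpecht F lam)) :
    f = ∑ k, act (Equiv.swap k (Fin.last m)) (iota ⟨f.1 (Equiv.swap k (Fin.last m)), f.2.1 _⟩) := by
  apply vv_ext
  intro s
  rw [vv_sum]
  simp only [vv_act, vv_iota, Function.comp_apply, Equiv.swap_apply_right]
  rfl

variable (F) in
/-- The generator of the induced module. -/
noncomputable def gen (T : Placement lam) : ↥(indSpecht F lam) :=
  iota ⟨polytabloid F T, Submodule.subset_span ⟨T, rfl⟩⟩

lemma vv_gen (T : Placement lam) (s : Fin (m + 1) → ℕ) :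
    vv (gen F T) s = if s (Fin.last m) = 0 then
      coef F lam.parts (s ∘ Fin.castSucc) (polytabloid F T) else 0 := vv_iota _ _

lemma EndInd_zero (T : Placement lam) {Φ : Module.End F ↥(indSpecht F lam)}
    (hΦ : Φ ∈ EndInd F lam) (h : Φ (gen F T) = 0) : Φ = 0 := by
  rw [mem_EndInd] at hΦ
  have h1 : ∀ y : ↥(Specht F lam), Φ (iota y) = 0 := by
    rintro ⟨y, hy⟩
    have hy' := hy
    unfold Specht at hy
    induction hy using Submodule.span_induction with
    | mem x h0 =>
      obtain ⟨T', rfl⟩ := h0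
      obtain ⟨g, rfl⟩ := exists_move T T'
      have h2 := iota_perm (F := F) g ⟨polytabloid F T, Submodule.subset_span ⟨T, rfl⟩⟩
      have h3 : (⟨polytabloid F (T.move g), hy'⟩ : ↥(Specht F lam)) =
        ⟨permM F lam.parts g (polytabloid F T),
          permM_specht g (Submodule.subset_span ⟨T, rfl⟩)⟩ := Subtype.ext (permM_poly T g).symm
      change Φ (iota ⟨polytabloid F (T.move g), hy'⟩) = 0
      rw [h3]
      refine (congrArg Φ h2).trans ?_
      rw [hΦ]
      change act _ (Φ (gen F T)) = 0
      rw [h, map_zero]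
    | zero =>
      have : (⟨0, hy'⟩ : ↥(Specht F lam)) = 0 := rfl
      rw [this, map_zero, map_zero]
    | add x y hx hy h1 h2 =>
      have h3 : (⟨x + y, hy'⟩ : ↥(Specht F lam)) = ⟨x, hx⟩ + ⟨y, hy⟩ := rfl
      rw [h3, map_add, map_add, h1 hx, h2 hy, add_zero]
    | smul r x hx h1 =>
      have h3 : (⟨r • x, hy'⟩ : ↥(Specht F lam)) = r • ⟨x, hx⟩ := rfl
      rw [h3, map_smul, map_smul, h1 hx, smul_zero]
  apply LinearMap.ext
  intro f
  rw [ind_expand f, map_sum]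
  simp only [hΦ, h1, map_zero, Finset.sum_const_zero, LinearMap.zero_apply]

variable (F lam) in
/-- The Jucys-Murphy type endomorphism. -/
noncomputable def LL : Module.End F ↥(indSpecht F lam) where
  toFun f := ⟨fun σ => ∑ x : Fin m, f.1 (σ * Equiv.swap (Fin.castSucc x) (Fin.last m)),
    fun σ => Submodule.sum_mem _ fun x _ => f.2.1 _,
    fun σ h => by
      rw [map_sum]
      refine Fintype.sum_equiv h _ _ ?_
      intro x
      rw [← f.2.2]
      congr 1
      rw [mul_assoc, mul_assoc]
      congr 1
      rw [← permIncl_cs]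
      conv_rhs => rw [← permIncl_last h]
      rw [Equiv.mul_swap_eq_swap_mul]⟩
  map_add' f g := by
    apply Subtype.ext
    funext σ
    simp [Finset.sum_add_distrib]
  map_smul' r f := by
    apply Subtype.ext
    funext σ
    simp [Finset.smul_sum]

lemma LL_apply (f : ↥(indSpecht F lam)) (σ) : (LL F lam f).1 σ =
    ∑ x : Fin m, f.1 (σ * Equiv.swap (Fin.castSucc x) (Fin.last m)) := rfl

lemma LL_mem : LL F lam ∈ EndInd F lam := by
  rw [mem_EndInd]
  intro g f
  apply Subtype.ext
  funext σ
  simp only [LL_apply, act_apply, mul_assoc]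

lemma LL_gen (T : Placement lam) : LL F lam (gen F T) =
    ∑ x : Fin m, act (Equiv.swap (Fin.castSucc x) (Fin.last m)) (gen F T) := by
  apply vv_ext
  intro s
  rw [vv_sum]
  simp only [vv_act]
  by_cases hk : ∃ k, s k = 0
  · obtain ⟨k0, hk0⟩ := hk
    rw [vv_eq _ (Equiv.swap k0 (Fin.last m)) (by simpa using hk0), LL_apply, map_sum]
    apply Finset.sum_congr rfl
    intro x _
    by_cases hx : k0 = Fin.castSucc x
    · subst hx
      rw [Equiv.swap_mul_self, vv_gen, Function.comp_apply, Equiv.swap_apply_right, if_pos hk0]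
      unfold gen
      rw [iota_one]
      rfl
    · rw [gen, iota_ne, map_zero]
      · symm
        by_cases hx2 : s (Fin.castSucc x) = 0
        · refine vv_two _ (a := Equiv.swap (Fin.castSucc x) (Fin.last m) k0) (b := Fin.last m)
            ?_ (by simpa using hk0) (by simpa using hx2)
          intro h
          have h2 := Equiv.swap_apply_left (Fin.castSucc x) (Fin.last m)
          exact hx (Equiv.injective _ (h.trans h2.symm))
        · have := vv_gen (F := F) T (s ∘ Equiv.swap (Fin.castSucc x) (Fin.last m))
          rw [if_neg (by simpa using hx2)] at this
          exact this
      · rw [Equiv.Perm.mul_apply, Equiv.swap_apply_right]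
        intro h
        have h2 : Equiv.swap k0 (Fin.last m) k0 = Fin.last m := Equiv.swap_apply_left _ _
        exact hx ((Equiv.injective _ (h.trans h2.symm))).symm
  · push Not at hk
    rw [vv_none _ hk, Finset.sum_eq_zero]
    intro x _
    exact vv_none _ fun k => hk _

end ind
end CarterPayne

namespace CarterPayne
open Finset

section annih
variable {F : Type*} [Field F] {m : ℕ} {lam : Partition m} (T : Placement lam)

/-- Transposition with the last symbol. -/
def tau (x : Fin m) : Equiv.Perm (Fin (m + 1)) := Equiv.swap (Fin.castSucc x) (Fin.last m)

/-- Transposition of two of the first symbols. -/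
def usw (x y : Fin m) : Equiv.Perm (Fin (m + 1)) := Equiv.swap (Fin.castSucc x) (Fin.castSucc y)

/-- The symbols of a column. -/
def colF (c : ℕ) : Finset (Fin m) := Finset.univ.filter fun y => (T.pos y).2 = c

lemma mem_colF {c : ℕ} {y : Fin m} : y ∈ colF T c ↔ (T.pos y).2 = c := by simp [colF]

lemma usw_last (x y : Fin m) : usw x y (Fin.last m) = Fin.last m :=
  Equiv.swap_apply_of_ne_of_ne (Fin.castSucc_ne_last _).symm (Fin.castSucc_ne_last _).symm

lemma usw_cs (x y k : Fin m) : usw x y (Fin.castSucc k) = Fin.castSucc (Equiv.swap x y k) := by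
  unfold usw
  rw [Equiv.swap_apply_def, Equiv.swap_apply_def]
  simp only [Fin.castSucc_inj]
  split_ifs <;> rfl

lemma vv_gen_usw (x y : Fin m) (s : Fin (m + 1) → ℕ) :
    vv (gen F T) (s ∘ usw x y) = if s (Fin.last m) = 0 then
      coef F lam.parts ((s ∘ Fin.castSucc) ∘ Equiv.swap x y) (polytabloid F T) else 0 := by
  rw [vv_gen]
  simp only [Function.comp_apply, usw_last]
  congr 2
  congr 1
  funext k
  simp only [Function.comp_apply, usw_cs]

variable {V : Type*} [AddCommGroup V] [Module F V]

/-- The relations satisfied by images of the generator. -/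
structure Good (A : Equiv.Perm (Fin (m + 1)) → V →ₗ[F] V) (u : V) : Prop where
  anti : ∀ y z, y ≠ z → (T.pos y).2 = (T.pos z).2 → A (usw y z) u = -u
  garnir : ∀ x c, (T.pos x).2 ≠ c →
    (∀ a, (a, (T.pos x).2) ∈ lam.cells → (a, c) ∈ lam.cells) →
    ∑ y ∈ colF T c, A (usw y x) u = u


/-- The abstract situation for the annihilation argument. -/
structure Sys (A : Equiv.Perm (Fin (m + 1)) → V →ₗ[F] V) (L : Module.End F V) (e : V) : Prop where
  mul : ∀ g h u, A g (A h u) = A (g * h) u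
  one : ∀ u, A 1 u = u
  comm : ∀ g u, L (A g u) = A g (L u)
  sum : L e = ∑ x : Fin m, A (tau x) e
  good : Good T A e

variable {A : Equiv.Perm (Fin (m + 1)) → V →ₗ[F] V} {L : Module.End F V} {e : V}

variable {T} in
lemma Good.map {u : V} (hu : Good T A u) {Φ : Module.End F V}
    (hΦ : ∀ g u, Φ (A g u) = A g (Φ u)) : Good T A (Φ u) := by
  constructor
  · intro y z hyz hc
    rw [← hΦ, hu.anti y z hyz hc, map_neg]
  · intro x c hxc hlen
    conv_rhs => rw [← hu.garnir x c hxc hlen]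
    rw [map_sum]
    simp only [hΦ]

variable (A) in
/-- The column sum of transpositions with the last symbol. -/
noncomputable def Cc (c : ℕ) : Module.End F V := ∑ y ∈ colF T c, A (tau y)

lemma Cc_apply (c : ℕ) (u : V) : Cc T A c u = ∑ y ∈ colF T c, A (tau y) u := by
  unfold Cc
  rw [LinearMap.sum_apply]

lemma tau_tau {x y : Fin m} (hxy : x ≠ y) : tau y * tau x = tau x * usw y x := by
  have h1 : (Fin.castSucc x) ≠ Fin.castSucc y := fun h => hxy (Fin.castSucc_injective _ h)
  have h2 := Fin.castSucc_ne_last x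
  have h3 := Fin.castSucc_ne_last y
  ext k
  simp only [tau, usw, Equiv.Perm.mul_apply, Equiv.swap_apply_def]
  congr 1
  split_ifs <;> simp_all

lemma tau_self (x : Fin m) : tau x * tau x = 1 := Equiv.swap_mul_self _ _

variable {T}

lemma cells_left {a c d : ℕ} (hc : 0 < c) (hcd : c ≤ d) (h : (a, d) ∈ lam.cells) :
    (a, c) ∈ lam.cells := ⟨h.1, hc, hcd.trans h.2.2⟩

lemma tau_w (hS : Sys T A L e) {u : V} (hu : Good T A u) {c : ℕ} {y : Fin m} (hy : y ∈ colF T c) :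
    A (tau y) (u - Cc T A c u) = -(u - Cc T A c u) := by
  have h1 : A (tau y) (Cc T A c u) = u - ∑ z ∈ (colF T c).erase y, A (tau z) u := by
    rw [Cc_apply, map_sum, ← Finset.add_sum_erase _ _ hy, hS.mul, tau_self, hS.one,
      sub_eq_add_neg, ← Finset.sum_neg_distrib]
    congr 1
    apply Finset.sum_congr rfl
    intro z hz
    rw [Finset.mem_erase] at hz
    rw [hS.mul, tau_tau hz.1, ← hS.mul, hu.anti y z hz.1.symm, map_neg]
    rw [mem_colF] at hy hz
    rw [hy, hz.2]
  rw [map_sub, h1, Cc_apply, ← Finset.add_sum_erase _ _ hy]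
  abel

lemma Cc_w (hS : Sys T A L e) {u : V} (hu : Good T A u) (c : ℕ) :
    Cc T A c (u - Cc T A c u) = -((colF T c).card : F) • (u - Cc T A c u) := by
  rw [Cc_apply, Finset.sum_congr rfl (fun y hy => tau_w hS hu hy), Finset.sum_const,
    neg_smul, smul_neg, Nat.cast_smul_eq_nsmul]

lemma right_w (hS : Sys T A L e) {u : V} (hu : Good T A u) {c : ℕ} (hc : 0 < c) {x : Fin m}
    (hx : c < (T.pos x).2) : Cc T A c (A (tau x) u) = A (tau x) u := by
  rw [Cc_apply]
  conv_rhs => rw [← hu.garnir x c hx.ne' (fun a => cells_left hc hx.le)]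
  rw [map_sum]
  apply Finset.sum_congr rfl
  intro y hy
  rw [mem_colF] at hy
  rw [hS.mul, tau_tau, hS.mul]
  rintro rfl
  omega

lemma right_wC (hS : Sys T A L e) {u : V} (hu : Good T A u) {c : ℕ} (hc : 0 < c) {j : ℕ}
    (hx : c < j) : Cc T A c (Cc T A j u) = Cc T A j u := by
  rw [Cc_apply T j, map_sum]
  apply Finset.sum_congr rfl
  intro x hx
  rw [mem_colF] at hx
  exact right_w hS hu hc (by omega)

lemma gen_L_split (hS : Sys T A L e) (N : ℕ) (hN : lam.parts 1 < N) :
    L (e) = ∑ j ∈ Finset.Ico 1 N, Cc T A j (e) := by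
  rw [hS.sum]
  rw [← Finset.sum_fiberwise_of_maps_to (s := Finset.univ) (t := Finset.Ico 1 N)
    (g := fun x => (T.pos x).2)]
  · apply Finset.sum_congr rfl
    intro j _
    rw [Cc_apply]
    rfl
  · intro x _
    rw [Finset.mem_Ico]
    have := T.mem x
    have h2 := lam.antitone one_pos this.1
    have h3 := this.2.1
    have h4 := this.2.2
    omega

lemma L_Cc (hS : Sys T A L e) (c : ℕ) (u : V) : L (Cc T A c u) = Cc T A c (L u) := by
  rw [Cc_apply, Cc_apply, map_sum]
  apply Finset.sum_congr rfl
  intro y _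
  exact hS.comm _ _

lemma main_identity (hS : Sys T A L e) {c : ℕ} (hc : 0 < c) (hc2 : c ≤ lam.parts 1 + 1) :
    L (e - Cc T A c (e)) =
      ((c : F) - 1 - ((colF T c).card : F)) • (e - Cc T A c (e)) -
      ∑ j ∈ Finset.Ico 1 c, ((e - Cc T A j (e)) -
        Cc T A c (e - Cc T A j (e))) := by
  have hu := hS.good
  have hL : L (e - Cc T A c e) = ∑ j ∈ Finset.Ico 1 (lam.parts 1 + 2),
      (Cc T A j e - Cc T A c (Cc T A j e)) := by
    rw [map_sub, L_Cc hS, gen_L_split hS (lam.parts 1 + 2) (by omega), map_sum,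
      Finset.sum_sub_distrib]
  have hs : Finset.Ico 1 (lam.parts 1 + 2) = Finset.Ico 1 c ∪ Finset.Ico c (lam.parts 1 + 2) :=
    (Finset.Ico_union_Ico_eq_Ico hc (by omega)).symm
  rw [hL, hs, Finset.sum_union (Finset.Ico_disjoint_Ico_consecutive _ _ _),
    Finset.sum_eq_sum_Ico_succ_bot (by omega : c < lam.parts 1 + 2)]
  have h3 : ∑ j ∈ Finset.Ico (c + 1) (lam.parts 1 + 2), (Cc T A j e - Cc T A c (Cc T A j e)) = 0 := by
    apply Finset.sum_eq_zero
    intro j hj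
    rw [Finset.mem_Ico] at hj
    rw [right_wC hS hu hc (by omega), sub_self]
  have h4 : Cc T A c e - Cc T A c (Cc T A c e) = -((colF T c).card : F) • (e - Cc T A c e) := by
    rw [← Cc_w hS hu, map_sub]
  have h5 : ∑ j ∈ Finset.Ico 1 c, (Cc T A j e - Cc T A c (Cc T A j e)) =
      ((c : F) - 1) • (e - Cc T A c e) -
      ∑ j ∈ Finset.Ico 1 c, ((e - Cc T A j e) - Cc T A c (e - Cc T A j e)) := by
    have : ((c : F) - 1) • (e - Cc T A c e) = ∑ j ∈ Finset.Ico 1 c, (e - Cc T A c e) := by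
      rw [Finset.sum_const, Nat.card_Ico, ← Nat.cast_smul_eq_nsmul F]
      rw [Nat.cast_sub hc]
      simp
    rw [this, ← Finset.sum_sub_distrib]
    apply Finset.sum_congr rfl
    intro j _
    rw [map_sub]
    abel
  rw [h3, h4, h5, add_zero, sub_smul _ ((colF T c).card : F), neg_smul]
  abel

lemma two_col (hS : Sys T A L e) {u : V} (hu : Good T A u) {c d : ℕ} (hcd : d ≠ c)
    (hlen : ∀ a, (a, d) ∈ lam.cells → (a, c) ∈ lam.cells) :
    Cc T A c (Cc T A d u) = Cc T A d u := by
  rw [Cc_apply, Cc_apply]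
  simp only [map_sum]
  rw [Finset.sum_comm]
  apply Finset.sum_congr rfl
  intro x hx
  rw [mem_colF] at hx
  conv_rhs => rw [← hu.garnir x c (by rw [hx]; exact hcd) (by rw [hx]; exact hlen)]
  rw [map_sum]
  apply Finset.sum_congr rfl
  intro y hy
  rw [mem_colF] at hy
  rw [hS.mul, tau_tau, hS.mul]
  rintro rfl
  omega

/-! Combinatorics of addable rows -/

lemma parts_pos_le {a : ℕ} (h : 0 < lam.parts a) : a ≤ m := by
  obtain ⟨T⟩ := exists_placement lam
  have ha : ∀ i : Fin a, ((i : ℕ) + 1, 1) ∈ lam.cells := by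
    intro i
    refine ⟨by simp, by simp, ?_⟩
    have := lam.antitone (show 0 < (i : ℕ) + 1 by omega) (show (i : ℕ) + 1 ≤ a by omega)
    simp only
    omega
  choose f hf using fun i => T.surj _ (ha i)
  have hinj : Function.Injective f := by
    intro i j hij
    have : T.pos (f i) = T.pos (f j) := by rw [hij]
    rw [hf, hf] at this
    simp only [Prod.mk.injEq, add_left_inj, and_true] at this
    exact Fin.ext this
  simpa using Fintype.card_le_of_injective f hinj

lemma mem_addRows {a : ℕ} : a ∈ addRows lam ↔
    1 ≤ a ∧ (a = 1 ∨ lam.parts a < lam.parts (a - 1)) := by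
  unfold addRows
  rw [Finset.mem_filter, Finset.mem_Icc]
  constructor
  · rintro ⟨⟨h1, _⟩, h2⟩
    exact ⟨h1, h2⟩
  · rintro ⟨h1, h2⟩
    refine ⟨⟨h1, ?_⟩, h2⟩
    rcases h2 with h2 | h2
    · omega
    · have := parts_pos_le (lam := lam) (a := a - 1) (by omega)
      omega

lemma addRows_anti {a b : ℕ} (ha : 1 ≤ a) (hb : b ∈ addRows lam) (hab : a < b) :
    lam.parts b < lam.parts a := by
  rw [mem_addRows] at hb
  rcases hb.2 with h | h
  · omega
  · have := lam.antitone (i := a) (j := b - 1) (by omega) (by omega)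
    omega

lemma addRows_inj {a b : ℕ} (ha : a ∈ addRows lam) (hb : b ∈ addRows lam)
    (h : lam.parts a = lam.parts b) : a = b := by
  rcases lt_trichotomy a b with h1 | h1 | h1
  · have := addRows_anti (mem_addRows.1 ha).1 hb h1; omega
  · exact h1
  · have := addRows_anti (mem_addRows.1 hb).1 ha h1; omega

lemma exists_addRow {a : ℕ} (ha : 1 ≤ a) : ∃ b ∈ addRows lam, lam.parts b = lam.parts a := by
  induction a with
  | zero => omega
  | succ n ih =>
    by_cases h0 : n = 0
    · exact ⟨n + 1, mem_addRows.2 ⟨by omega, by left; omega⟩, rfl⟩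
    · by_cases h1 : lam.parts (n + 1) < lam.parts n
      · exact ⟨n + 1, mem_addRows.2 ⟨by omega, by right; simpa using h1⟩, rfl⟩
      · obtain ⟨b, hb, hb2⟩ := ih (by omega)
        refine ⟨b, hb, ?_⟩
        have := lam.antitone (i := n) (j := n + 1) (by omega) (by omega)
        omega

lemma colF_card {a : ℕ} (ha : a ∈ addRows lam) :
    (colF T (lam.parts a + 1)).card = a - 1 := by
  have h : (colF T (lam.parts a + 1)).card = (Finset.Icc 1 (a - 1)).card := by
    refine Finset.card_bij (fun y _ => (T.pos y).1) ?_ ?_ ?_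
    · intro y hy
      rw [mem_colF] at hy
      have h1 := T.mem y
      rw [Finset.mem_Icc]
      refine ⟨h1.1, ?_⟩
      by_contra hc
      have := lam.antitone (i := a) (j := (T.pos y).1) (mem_addRows.1 ha).1 (by omega)
      have h2 := h1.2.2
      omega
    · intro y hy z hz h
      rw [mem_colF] at hy hz
      exact T.inj (Prod.ext h (hy.trans hz.symm))
    · intro i hi
      rw [Finset.mem_Icc] at hi
      have := addRows_anti hi.1 ha (by omega)
      obtain ⟨y, hy⟩ := T.surj (i, lam.parts a + 1) ⟨hi.1, by simp, this⟩
      exact ⟨y, by rw [mem_colF, hy], by rw [hy]⟩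
  rw [h, Nat.card_Icc]
  omega

open Polynomial in
variable (F lam) in
/-- Partial product of the annihilating polynomial. -/
noncomputable def Zp (c : ℕ) : Polynomial F :=
  ∏ a ∈ (addRows lam).filter (fun a => lam.parts a + 1 ≤ c),
    (X - C ((((lam.parts a : ℤ) + 1 - (a : ℤ) : ℤ)) : F))

lemma aeval_comm (hL : ∀ g u, L (A g u) = A g (L u)) (q : Polynomial F) (g : Equiv.Perm (Fin (m + 1)))
    (u : V) : Polynomial.aeval L q (A g u) = A g (Polynomial.aeval L q u) := by
  have hc : Commute L (A g) := LinearMap.ext fun u => hL g u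
  induction q using Polynomial.induction_on' with
  | add p q hp hq => simp only [map_add, LinearMap.add_apply, hp, hq]
  | monomial n a =>
    rw [Polynomial.aeval_monomial]
    have h2 : Commute (algebraMap F (Module.End F V) a * L ^ n) (A g) :=
      Commute.mul_left (Algebra.commutes a (A g)) (hc.pow_left n)
    exact LinearMap.congr_fun h2 u

lemma aeval_Cc (hS : Sys T A L e) (q : Polynomial F) (c : ℕ) (u : V) :
    Polynomial.aeval (L) q (Cc T A c u) = Cc T A c (Polynomial.aeval (L) q u) := by
  rw [Cc_apply, Cc_apply, map_sum]
  apply Finset.sum_congr rfl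
  intro y _
  exact aeval_comm hS.comm q _ _

lemma Zp_dvd {c d : ℕ} (h : c ≤ d) : Zp F lam c ∣ Zp F lam d := by
  unfold Zp
  apply Finset.prod_dvd_prod_of_subset
  intro a ha
  rw [Finset.mem_filter] at ha ⊢
  exact ⟨ha.1, by omega⟩

lemma Zp_w (hS : Sys T A L e) (c : ℕ) (hc : 0 < c) (hc2 : c ≤ lam.parts 1 + 1) :
    Polynomial.aeval (L) (Zp F lam c) (e - Cc T A c (e)) = 0 := by
  induction c using Nat.strong_induction_on with
  | _ c ih =>
  have hlow : ∀ j, 0 < j → j < c →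
      Polynomial.aeval (L) (Zp F lam (c - 1)) (e - Cc T A j (e)) = 0 := by
    intro j hj hjc
    obtain ⟨q, hq⟩ := Zp_dvd (F := F) (lam := lam) (show j ≤ c - 1 by omega)
    rw [hq, mul_comm, map_mul, Module.End.mul_apply, ih j hjc hj (by omega), map_zero]
  by_cases hadd : ∃ a ∈ addRows lam, lam.parts a + 1 = c
  · obtain ⟨a, ha, hac⟩ := hadd
    have hZ : Zp F lam c = Zp F lam (c - 1) *
        (Polynomial.X - Polynomial.C ((((lam.parts a : ℤ) + 1 - (a : ℤ) : ℤ)) : F)) := by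
      unfold Zp
      have : (addRows lam).filter (fun a => lam.parts a + 1 ≤ c) =
          insert a ((addRows lam).filter (fun a => lam.parts a + 1 ≤ c - 1)) := by
        ext b
        simp only [Finset.mem_filter, Finset.mem_insert]
        constructor
        · rintro ⟨h1, h2⟩
          by_cases h3 : lam.parts b + 1 ≤ c - 1
          · exact Or.inr ⟨h1, h3⟩
          · left
            exact addRows_inj h1 ha (by omega)
        · rintro (rfl | ⟨h1, h2⟩)
          · exact ⟨ha, by omega⟩
          · exact ⟨h1, by omega⟩
      rw [this, Finset.prod_insert, mul_comm]
      rw [Finset.mem_filter]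
      omega
    have hcard := colF_card (T := T) ha
    rw [hac] at hcard
    have ha1 := (mem_addRows.1 ha).1
    have hres : ((((lam.parts a : ℤ) + 1 - (a : ℤ) : ℤ)) : F) =
        (c : F) - 1 - ((colF T c).card : F) := by
      rw [hcard, ← hac, Nat.cast_sub ha1]
      push_cast
      ring
    rw [hZ, map_mul, Module.End.mul_apply, map_sub (Polynomial.aeval (R := F) L), Polynomial.aeval_X,
      Polynomial.aeval_C,
      LinearMap.sub_apply, main_identity hS hc hc2, Module.algebraMap_end_apply, hres]
    rw [sub_right_comm, sub_self, zero_sub, map_neg, map_sum, neg_eq_zero]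
    apply Finset.sum_eq_zero
    intro j hj
    rw [Finset.mem_Ico] at hj
    rw [map_sub, aeval_Cc hS, hlow j (by omega) (by omega), map_zero, sub_zero]
  · push Not at hadd
    have hZ : Zp F lam c = Zp F lam (c - 1) := by
      unfold Zp
      congr 1
      ext b
      simp only [Finset.mem_filter]
      constructor
      · rintro ⟨h1, h2⟩
        have := hadd b h1
        exact ⟨h1, by omega⟩
      · rintro ⟨h1, h2⟩
        exact ⟨h1, by omega⟩
    have hno : ∀ a, 1 ≤ a → lam.parts a + 1 ≠ c := by
      intro a ha h
      obtain ⟨b, hb, hb2⟩ := exists_addRow (lam := lam) ha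
      exact hadd b hb (by omega)
    have hc1 : c ≠ 1 := by
      rintro rfl
      have h1 := hno (m + 1) (by omega)
      apply h1
      by_contra h2
      have := parts_pos_le (lam := lam) (a := m + 1) (by omega)
      omega
    have hu := hS.good.map (aeval_comm hS.comm (Zp F lam (c - 1)))
    have h1 := hlow (c - 1) (by omega) (by omega)
    rw [map_sub, aeval_Cc hS, sub_eq_zero] at h1
    rw [hZ, map_sub, aeval_Cc hS, sub_eq_zero]
    have h2 := two_col hS hu (c := c) (d := c - 1) (by omega) (by
      rintro a ⟨h3, h4, h5⟩
      have := hno a h3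
      simp only at h5
      exact ⟨h3, hc, by simp only; omega⟩)
    rw [← h1] at h2
    exact h2.symm

open Polynomial in
variable (F lam) in
/-- The annihilating polynomial. -/
noncomputable def Pp : Polynomial F :=
  ∏ a ∈ addRows lam, (X - C ((((lam.parts a : ℤ) + 1 - (a : ℤ) : ℤ)) : F))

lemma annih_sys (hS : Sys T A L e) : Polynomial.aeval L (Pp F lam) e = 0 := by
  have h := Zp_w hS (lam.parts 1 + 1) (by omega) le_rfl
  have h1 : Cc T A (lam.parts 1 + 1) (e) = 0 := by
    rw [Cc_apply, Finset.sum_eq_zero]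
    intro y hy
    rw [mem_colF] at hy
    have h2 := T.mem y
    have h3 := lam.antitone one_pos h2.1
    have h4 := h2.2.2
    omega
  rw [h1, sub_zero] at h
  rw [← h]
  congr 2
  unfold Pp Zp
  rw [Finset.filter_true_of_mem]
  intro a ha
  have := lam.antitone one_pos (mem_addRows.1 ha).1
  omega

section inst
variable (T)
lemma good_gen : Good T (fun g => act g) (gen F T) := by
  constructor
  · intro y z hyz hc
    apply vv_ext
    intro s
    rw [vv_act, vv_gen_usw, vv_neg, vv_gen]
    split_ifs
    · exact poly_anti T hyz hc _
    · simp
  · intro x c hxc hlen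
    apply vv_ext
    intro s
    rw [vv_sum]
    simp only [vv_act, vv_gen_usw]
    rw [vv_gen]
    split_ifs
    · exact poly_garnir T hxc hlen _
    · simp

lemma act_act (g h : Equiv.Perm (Fin (m + 1))) (u : ↥(indSpecht F lam)) :
    act g (act h u) = act (g * h) u := by
  apply vv_ext
  intro s
  simp only [vv_act]
  rfl

lemma act_one (u : ↥(indSpecht F lam)) :
    act (1 : Equiv.Perm (Fin (m + 1))) u = u := by
  apply vv_ext
  intro s
  simp only [vv_act]
  rfl

lemma aeval_mem_End (q : Polynomial F) : Polynomial.aeval (LL F lam) q ∈ EndInd F lam := by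
  have := (Polynomial.aeval (⟨LL F lam, LL_mem⟩ : ↥(EndInd F lam)) q).2
  rwa [Polynomial.aeval_subalgebra_coe] at this

lemma sys_gen (T : Placement lam) : Sys T (fun g => act g) (LL F lam) (gen F T) where
  mul := act_act
  one := act_one
  comm := mem_EndInd.1 LL_mem
  sum := LL_gen T
  good := good_gen T

theorem annihilate : Polynomial.aeval (LL F lam) (Pp F lam) = 0 := by
  obtain ⟨T⟩ := exists_placement lam
  apply EndInd_zero T (aeval_mem_End _)
  have h := annih_sys (sys_gen (F := F) T)
  exact h

end inst
end annih
end CarterPayne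

namespace CarterPayne
open Finset

section lower
variable {F : Type*} [Field F] {m : ℕ} {lam : Partition m} (T : Placement lam)

variable (F) in
/-- Coefficients of the powers of the Jucys-Murphy operator on the generator. -/
noncomputable def vj (j : ℕ) (s : Fin (m + 1) → ℕ) : F := vv ((LL F lam ^ j) (gen F T)) s

lemma LLpow_act (j : ℕ) (g : Equiv.Perm (Fin (m + 1))) (u : ↥(indSpecht F lam)) :
    (LL F lam ^ j) (act g u) = act g ((LL F lam ^ j) u) := by
  have h : LL F lam ^ j ∈ EndInd F lam := Subalgebra.pow_mem _ LL_mem j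
  exact (mem_EndInd.1 h) g u

lemma vj_succ (j : ℕ) (s : Fin (m + 1) → ℕ) :
    vj F T (j + 1) s = ∑ x : Fin m, vj F T j (s ∘ tau x) := by
  unfold vj
  rw [pow_succ, Module.End.mul_apply, LL_gen, map_sum, vv_sum]
  apply Finset.sum_congr rfl
  intro x _
  rw [LLpow_act, vv_act]
  rfl

open Classical in
/-- The symbols sent outside the diagram. -/
noncomputable def outS (s : Fin (m + 1) → ℕ) : Finset (Fin m) :=
  Finset.univ.filter fun z => (s (Fin.castSucc z), (T.pos z).2) ∉ lam.cells

lemma mem_outS {s : Fin (m + 1) → ℕ} {z : Fin m} :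
    z ∈ outS T s ↔ (s (Fin.castSucc z), (T.pos z).2) ∉ lam.cells := by
  simp [outS]

lemma tau_ne {x z : Fin m} (h : z ≠ x) : tau x (Fin.castSucc z) = Fin.castSucc z :=
  Equiv.swap_apply_of_ne_of_ne (fun h2 => h (Fin.castSucc_injective _ h2)) (Fin.castSucc_ne_last _)

lemma tau_eq (x : Fin m) : tau x (Fin.castSucc x) = Fin.last m := Equiv.swap_apply_left _ _

lemma tau_last (x : Fin m) : tau x (Fin.last m) = Fin.castSucc x := Equiv.swap_apply_right _ _

lemma outS_sub (s : Fin (m + 1) → ℕ) (x : Fin m) : outS T s ⊆ insert x (outS T (s ∘ tau x)) := by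
  intro z hz
  rw [Finset.mem_insert]
  by_cases h : z = x
  · exact Or.inl h
  · right
    rw [mem_outS] at hz ⊢
    rwa [Function.comp_apply, tau_ne h]

lemma vj_conf (j : ℕ) : ∀ s, vj F T j s ≠ 0 → (outS T s).card ≤ j ∧ ((outS T s).card = j →
    ∀ y z : Fin m, y ≠ z → y ∉ outS T s → z ∉ outS T s →
      s (Fin.castSucc y) = s (Fin.castSucc z) → (T.pos y).2 ≠ (T.pos z).2) := by
  induction j with
  | zero =>
    intro s hs
    unfold vj at hs
    rw [pow_zero, Module.End.one_apply, vv_gen] at hs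
    split_ifs at hs with h0
    · have h1 : outS T s = ∅ := by
        rw [Finset.eq_empty_iff_forall_notMem]
        intro z hz
        rw [mem_outS] at hz
        exact hz (poly_in T hs z)
      refine ⟨by rw [h1]; simp, ?_⟩
      intro _ y z hyz _ _ hsyz hc
      exact hs (poly_conf T hyz hc hsyz)
    · exact absurd rfl hs
  | succ j ih =>
    intro s hs
    rw [vj_succ] at hs
    obtain ⟨x, _, hx⟩ := Finset.exists_ne_zero_of_sum_ne_zero hs
    obtain ⟨h1, h2⟩ := ih _ hx
    have h3 := Finset.card_le_card (outS_sub T s x)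
    have h4 := Finset.card_insert_le x (outS T (s ∘ tau x))
    refine ⟨by omega, ?_⟩
    intro h5 y z hyz hy hz hsyz
    have hxo : x ∈ outS T s := by
      by_contra hxo
      have : outS T s ⊆ outS T (s ∘ tau x) := by
        intro z hz
        have := outS_sub T s x hz
        rw [Finset.mem_insert] at this
        rcases this with rfl | h
        · exact absurd hz hxo
        · exact h
      have := Finset.card_le_card this
      omega
    have hyx : y ≠ x := by rintro rfl; exact hy hxo
    have hzx : z ≠ x := by rintro rfl; exact hz hxo
    refine h2 (by omega) y z hyz ?_ ?_ ?_
    · rw [mem_outS] at hy ⊢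
      rwa [Function.comp_apply, tau_ne hyx]
    · rw [mem_outS] at hz ⊢
      rwa [Function.comp_apply, tau_ne hzx]
    · rw [Function.comp_apply, Function.comp_apply, tau_ne hyx, tau_ne hzx, hsyz]

/-- The symbol at a cell (last symbol of `Fin m` irrelevant: junk otherwise). -/
lemma poly_own : coef F lam.parts (fun k => (T.pos k).1) (polytabloid F T) = 1 := by
  classical
  rw [coef_poly, Finset.sum_eq_single 1]
  · simp
  · intro π hπ hπ1
    rw [if_neg, mul_zero]
    intro h
    apply hπ1
    rw [mem_colStab] at hπ
    ext k
    have : π k = k := T.inj (Prod.ext (congrFun h k).symm (hπ k))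
    rw [this]; rfl
  · intro h
    exfalso
    apply h
    rw [mem_colStab]
    intro k
    rfl

lemma exists_row_list {d : ℕ} (hd : d < (addRows lam).card) :
    ∃ l : List ℕ, l.length = d ∧ (∀ a ∈ l, 0 < lam.parts a) ∧
      l.Pairwise (fun a b => lam.parts b < lam.parts a) := by
  set S := (addRows lam).filter (fun a => 0 < lam.parts a)
  have hS : d ≤ S.card := by
    have h1 := Finset.card_filter_add_card_filter_not (s := addRows lam)
      (fun a => 0 < lam.parts a)
    have h2 : ((addRows lam).filter (fun a => ¬ 0 < lam.parts a)).card ≤ 1 := by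
      rw [Finset.card_le_one]
      intro a ha b hb
      rw [Finset.mem_filter] at ha hb
      exact addRows_inj ha.1 hb.1 (by omega)
    have h3 : S.card = ((addRows lam).filter (fun a => 0 < lam.parts a)).card := rfl
    omega
  obtain ⟨S', hS', hc⟩ := Finset.exists_subset_card_eq hS
  refine ⟨S'.sort (· ≤ ·), by rw [Finset.length_sort, hc], ?_, ?_⟩
  · intro a ha
    rw [Finset.mem_sort] at ha
    exact (Finset.mem_filter.1 (hS' ha)).2
  · have h1 := Finset.sortedLT_sort S'
    refine (List.Pairwise.imp_of_mem ?_ h1.pairwise)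
    intro a b ha hb hab
    rw [Finset.mem_sort] at ha hb
    exact addRows_anti (mem_addRows.1 (Finset.mem_filter.1 (hS' ha)).1).1
      (Finset.mem_filter.1 (hS' hb)).1 hab

/-- the test tabloids: properties packaged -/
lemma exists_test (l : List ℕ) (hpos : ∀ a ∈ l, 0 < lam.parts a)
    (hl : l.Pairwise (fun a b => lam.parts b < lam.parts a)) :
    ∃ s : Fin (m + 1) → ℕ, s (Fin.last m) = l.headD 0 ∧ (outS T s).card = l.length ∧
      (∀ z, z ∈ outS T s ↔ ∃ a ∈ l, T.pos z = (a, lam.parts a)) ∧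
      (∀ z, z ∉ outS T s → s (Fin.castSucc z) = (T.pos z).1) ∧
      vj F T l.length s = 1 := by
  induction l with
  | nil =>
    refine ⟨Fin.snoc (α := fun _ => ℕ) (fun k => (T.pos k).1) 0, by simp, ?_, ?_, ?_, ?_⟩
    · simp only [List.length_nil, Finset.card_eq_zero, Finset.eq_empty_iff_forall_notMem, mem_outS]
      intro z
      simpa using T.mem z
    · intro z
      rw [mem_outS]
      simpa using T.mem z
    · intro z _
      simp
    · unfold vj
      rw [List.length_nil, pow_zero, Module.End.one_apply, vv_gen, if_pos (by simp)]
      rw [← poly_own (F := F) T]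
      congr 1
      congr 1
      funext k
      simp
  | cons ρ l ih =>
    rw [List.pairwise_cons] at hl
    obtain ⟨s, h1, h2, h3, h4, h5⟩ := ih (fun a ha => hpos a (by simp [ha])) hl.2
    have hρ := hpos ρ (by simp)
    have hρ0 : 0 < ρ := by
      rcases Nat.eq_zero_or_pos ρ with h | h
      · rw [h, lam.parts_zero] at hρ; omega
      · exact h
    obtain ⟨x, hx⟩ := T.surj (ρ, lam.parts ρ) ⟨hρ0, hρ, le_rfl⟩
    have hxs : x ∉ outS T s := by
      rw [h3]
      rintro ⟨a, ha, h⟩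
      rw [hx, Prod.mk.injEq] at h
      have := hl.1 a ha
      omega
    have hxo : x ∈ outS T (s ∘ tau x) := by
      rw [mem_outS, Function.comp_apply, tau_eq, h1, hx]
      rintro ⟨h6, h7, h8⟩
      cases l with
      | nil => simp at h6
      | cons a l =>
        have := hl.1 a (by simp)
        simp at h8
        omega
    have hout : outS T (s ∘ tau x) = insert x (outS T s) := by
      ext z
      rw [Finset.mem_insert]
      by_cases hz : z = x
      · subst hz; simp [hxo]
      · rw [mem_outS, mem_outS, Function.comp_apply, tau_ne hz]
        simp [hz]
    have hcard : (outS T (s ∘ tau x)).card = (ρ :: l).length := by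
      rw [hout, Finset.card_insert_of_notMem hxs, h2]; simp
    have hlast : (s ∘ tau x) (Fin.last m) = ρ := by
      rw [Function.comp_apply, tau_last, h4 x hxs, hx]
    refine ⟨s ∘ tau x, by simpa using hlast, hcard, ?_, ?_, ?_⟩
    · intro z
      rw [hout, Finset.mem_insert, h3]
      simp only [List.mem_cons, exists_eq_or_imp]
      rw [← hx]
      constructor
      · rintro (rfl | h)
        · exact Or.inl rfl
        · exact Or.inr h
      · rintro (h | h)
        · exact Or.inl (T.inj h)
        · exact Or.inr h
    · intro z hz
      rw [hout, Finset.mem_insert, not_or] at hz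
      rw [Function.comp_apply, tau_ne hz.1, h4 z hz.2]
    · rw [List.length_cons, vj_succ, Finset.sum_eq_single x]
      · have : (s ∘ tau x) ∘ tau x = s := by
          funext k
          simp [tau]
        rw [this, h5]
      · intro z _ hzx
        by_contra hne
        obtain ⟨h6, h7⟩ := vj_conf T _ _ hne
        -- the element `z` was out, becomes in
        have hzo : z ∈ outS T (s ∘ tau x) := by
          by_contra hzo
          have : outS T (s ∘ tau x) ⊆ outS T ((s ∘ tau x) ∘ tau z) := by
            intro y hy
            have := outS_sub T _ z hy
            rw [Finset.mem_insert] at this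
            rcases this with rfl | h
            · exact absurd hy hzo
            · exact h
          have := Finset.card_le_card this
          rw [hcard, List.length_cons] at this
          omega
        have h8 : (outS T ((s ∘ tau x) ∘ tau z)).card = l.length := by
          have h9 := Finset.card_le_card (outS_sub T (s ∘ tau x) z)
          have h10 := Finset.card_insert_le z (outS T ((s ∘ tau x) ∘ tau z))
          rw [hcard, List.length_cons] at h9
          omega
        rw [hout, Finset.mem_insert] at hzo
        have hzo2 := hzo.resolve_left hzx
        rw [h3] at hzo2
        obtain ⟨a, ha, hza⟩ := hzo2
        have hlt := hl.1 a ha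
        have hap := hpos a (by simp [ha])
        have hcell : (ρ, lam.parts a) ∈ lam.cells := ⟨hρ0, hap, hlt.le⟩
        obtain ⟨y, hy⟩ := T.surj _ hcell
        have hyz : z ≠ y := by
          rintro rfl
          rw [hy, Prod.mk.injEq] at hza
          rw [hza.1] at hlt
          omega
        have hyx : y ≠ x := by
          rintro rfl
          rw [hy, Prod.mk.injEq] at hx
          omega
        have hyo : y ∉ outS T s := by
          rw [h3]
          rintro ⟨b, hb, h⟩
          rw [hy, Prod.mk.injEq] at h
          have := hl.1 b hb
          rw [h.1] at this
          omega
        have hzv : ((s ∘ tau x) ∘ tau z) (Fin.castSucc z) = ρ := by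
          rw [Function.comp_apply, tau_eq, hlast]
        have hyv : ((s ∘ tau x) ∘ tau z) (Fin.castSucc y) = ρ := by
          rw [Function.comp_apply, tau_ne hyz.symm, Function.comp_apply, tau_ne hyx, h4 y hyo, hy]
        refine h7 h8 z y hyz ?_ ?_ (by rw [hzv, hyv]) (by rw [hza, hy])
        · rw [mem_outS, hzv, hza, not_not]
          exact hcell
        · rw [mem_outS, hyv, hy, not_not]
          exact hcell
      · simp

theorem indep {q : Polynomial F} (hq : Polynomial.aeval (LL F lam) q = 0)
    (hdeg : q.natDegree < (addRows lam).card) : q = 0 := by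
  obtain ⟨T⟩ := exists_placement lam
  obtain ⟨l, hl, hpos, hl2⟩ := exists_row_list hdeg
  obtain ⟨s, -, h2, -, -, h5⟩ := exists_test (F := F) T l hpos hl2
  have h6 : vv (Polynomial.aeval (LL F lam) q (gen F T)) s = 0 := by
    rw [hq, LinearMap.zero_apply, vv_zero]
  rw [Polynomial.aeval_eq_sum_range, LinearMap.sum_apply, vv_sum,
    Finset.sum_eq_single q.natDegree] at h6
  · rw [LinearMap.smul_apply, vv_smul] at h6
    rw [hl] at h5
    unfold vj at h5
    rw [h5, mul_one] at h6
    exact Polynomial.leadingCoeff_eq_zero.1 h6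
  · intro j hj hjn
    rw [Finset.mem_range] at hj
    rw [LinearMap.smul_apply, vv_smul]
    have : vj F T j s = 0 := by
      by_contra hne
      have := (vj_conf T _ _ hne).1
      omega
    unfold vj at this
    rw [this, mul_zero]
  · simp

end lower
end CarterPayne

namespace CarterPayne
open Finset

section upper
variable {F : Type*} [Field F] {m : ℕ} {lam : Partition m} (T : Placement lam)

/-- The relations satisfied by the coefficient function of an image of the generator. -/
structure VP (v : (Fin (m + 1) → ℕ) → F) : Prop where
  anti : ∀ y z, y ≠ z → (T.pos y).2 = (T.pos z).2 → ∀ s, v (s ∘ usw y z) = -v s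
  garnir : ∀ x c, (T.pos x).2 ≠ c →
    (∀ a, (a, (T.pos x).2) ∈ lam.cells → (a, c) ∈ lam.cells) →
    ∀ s, ∑ y ∈ colF T c, v (s ∘ usw y x) = v s
  row : ∀ a b, 0 < a → a < b → ∀ s : Fin (m + 1) → ℕ,
    ∑ k ∈ Finset.univ.filter (fun k => s k = a), v (Function.update s k b) = 0
  sizes : ∀ s, v s ≠ 0 → ∀ i,
    (Finset.univ.filter fun z => s z = i).card = if i = 0 then 1 else lam.parts i
  conf : ∀ y z, y ≠ z → (T.pos y).2 = (T.pos z).2 → ∀ s : Fin (m + 1) → ℕ,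
    s (Fin.castSucc y) = s (Fin.castSucc z) → v s = 0

/-- The shifted tableau. -/
def Tt : Fin (m + 1) → ℕ := Fin.snoc (α := fun _ => ℕ)
  (fun k => if (T.pos k).2 < lam.parts (T.pos k).1 then (T.pos k).1 else (T.pos k).1 + 1) 1

lemma Tt_last : Tt T (Fin.last m) = 1 := by simp [Tt]

lemma Tt_cs (k : Fin m) : 1 ≤ (T.pos k).1 ∧ 1 ≤ (T.pos k).2 ∧
    (((T.pos k).2 < lam.parts (T.pos k).1 ∧ Tt T (Fin.castSucc k) = (T.pos k).1) ∨
    ((T.pos k).2 = lam.parts (T.pos k).1 ∧ Tt T (Fin.castSucc k) = (T.pos k).1 + 1)) := by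
  obtain ⟨h1, h2, h3⟩ := T.mem k
  refine ⟨h1, h2, ?_⟩
  simp only [Tt, Fin.snoc_castSucc]
  split_ifs with h
  · exact Or.inl ⟨h, rfl⟩
  · exact Or.inr ⟨by omega, rfl⟩

lemma Tt_pos (z : Fin (m + 1)) : 1 ≤ Tt T z := by
  refine Fin.lastCases ?_ (fun k => ?_) z
  · rw [Tt_last]
  · have := Tt_cs T k
    omega

/-- The special element for row `i`. -/
def isE (i : ℕ) (E : Fin (m + 1)) : Prop :=
  (i = 1 ∧ E = Fin.last m) ∨
    (2 ≤ i ∧ ∃ k, E = Fin.castSucc k ∧ T.pos k = (i - 1, lam.parts (i - 1)))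

lemma exists_E {i : ℕ} (hi : 1 ≤ i) (h : i = 1 ∨ 0 < lam.parts (i - 1)) : ∃ E, isE T i E := by
  by_cases h1 : i = 1
  · exact ⟨_, Or.inl ⟨h1, rfl⟩⟩
  · obtain ⟨k, hk⟩ := T.surj (i - 1, lam.parts (i - 1))
      ⟨by simp only; omega, h.resolve_left h1, le_rfl⟩
    exact ⟨_, Or.inr ⟨by omega, k, rfl, hk⟩⟩

variable {T}

lemma isE_Tt {i : ℕ} {E : Fin (m + 1)} (hE : isE T i E) : Tt T E = i := by
  rcases hE with ⟨rfl, rfl⟩ | ⟨h2, k, rfl, hk⟩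
  · exact Tt_last T
  · have := Tt_cs T k
    rw [hk] at this
    simp only at this
    omega

lemma isE_cs {i : ℕ} {k : Fin m} (hE : isE T i (Fin.castSucc k)) :
    2 ≤ i ∧ T.pos k = (i - 1, lam.parts (i - 1)) := by
  rcases hE with ⟨_, h⟩ | ⟨h2, l, h, hk⟩
  · exact absurd h (Fin.castSucc_ne_last k)
  · rw [Fin.castSucc_inj] at h
    subst h
    exact ⟨h2, hk⟩

lemma rem_cases {i : ℕ} {E : Fin (m + 1)} (hE : isE T i E) {z : Fin (m + 1)} (hi : 1 ≤ i)
    (hz : i ≤ Tt T z) : z = E ∨ ∃ k, z = Fin.castSucc k ∧ i ≤ (T.pos k).1 := by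
  induction z using Fin.lastCases with
  | last =>
    rw [Tt_last] at hz
    rcases hE with ⟨rfl, rfl⟩ | ⟨h2, k, rfl, hk⟩
    · exact Or.inl rfl
    · omega
  | cast k =>
    by_cases h : i ≤ (T.pos k).1
    · exact Or.inr ⟨k, rfl, h⟩
    · left
      have h3 := Tt_cs T k
      rcases hE with ⟨rfl, rfl⟩ | ⟨h2, l, rfl, hl⟩
      · omega
      · have h4 : (T.pos k).1 = i - 1 := by omega
        rw [h4] at h3
        congr 1
        apply T.inj
        rw [hl]
        exact Prod.ext h4 (by simp only; omega)

lemma cs_Tt_ge {i : ℕ} {k : Fin m} (h : i ≤ (T.pos k).1) : i ≤ Tt T (Fin.castSucc k) := by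
  have := Tt_cs T k
  omega

variable (T) in
/-- `s` agrees with the shifted tableau in rows less than `i`. -/
def Kc (i : ℕ) (s : Fin (m + 1) → ℕ) : Prop := ∀ z, Tt T z < i → s z = Tt T z

lemma usw_left (k l : Fin m) : usw k l (Fin.castSucc k) = Fin.castSucc l := Equiv.swap_apply_left _ _

lemma usw_right (k l : Fin m) : usw k l (Fin.castSucc l) = Fin.castSucc k :=
  Equiv.swap_apply_right _ _

lemma usw_ne {k l : Fin m} {z : Fin (m + 1)} (h1 : z ≠ Fin.castSucc k) (h2 : z ≠ Fin.castSucc l) :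
    usw k l z = z := Equiv.swap_apply_of_ne_of_ne h1 h2

lemma Kc_swap {i : ℕ} {s : Fin (m + 1) → ℕ} (hK : Kc T i s) {k l : Fin m}
    (hk : i ≤ Tt T (Fin.castSucc k)) (hl : i ≤ Tt T (Fin.castSucc l)) :
    Kc T i (s ∘ usw k l) := by
  intro z hz
  rw [Function.comp_apply, usw_ne]
  · exact hK z hz
  · rintro rfl; omega
  · rintro rfl; omega

lemma Kc_ge {i : ℕ} {s : Fin (m + 1) → ℕ} (hK : Kc T i s) {z : Fin (m + 1)} (h : i ≤ s z) :
    i ≤ Tt T z := by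
  by_contra hc
  have := hK z (by omega)
  omega

variable {v : (Fin (m + 1) → ℕ) → F}

lemma swap_zero (hv : VP T v) {k l : Fin m} (hkl : k ≠ l) (hc : (T.pos k).2 = (T.pos l).2)
    {s : Fin (m + 1) → ℕ} (h : v (s ∘ usw k l) = 0) : v s = 0 := by
  rw [hv.anti k l hkl hc] at h
  exact neg_eq_zero.1 h

lemma Tt_card {i j : ℕ} (hi : i = 1 ∨ 0 < lam.parts (i - 1)) (hj : 1 ≤ j) (hji : j < i) :
    lam.parts j ≤ (Finset.univ.filter fun z => Tt T z = j).card := by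
  have hpos : ∀ l, 1 ≤ l → l ≤ j → 0 < lam.parts l := by
    intro l hl hlj
    have := lam.antitone (i := l) (j := i - 1) hl (by omega)
    omega
  obtain ⟨E, hE⟩ := exists_E T hj (by
    by_cases h : j = 1
    · exact Or.inl h
    · exact Or.inr (hpos _ (by omega) (by omega)))
  rw [← rowFiber_card T j]
  have hEt := isE_Tt hE
  apply Finset.card_le_card_of_injOn
    (fun k => if (T.pos k).2 < lam.parts j then Fin.castSucc k else E)
  · intro k hk
    simp only [Finset.coe_filter, Finset.mem_univ, true_and, Set.mem_ofPred_eq] at hk ⊢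
    have := Tt_cs T k
    rw [hk] at this
    split_ifs with h
    · omega
    · exact hEt
  · intro k hk l hl hkl
    simp only [Finset.coe_filter, Finset.mem_univ, true_and, Set.mem_ofPred_eq] at hk hl hkl
    have hk2 := T.mem k
    have hl2 := T.mem l
    have hk3 := hk2.2.2
    have hl3 := hl2.2.2
    rw [hk] at hk3
    rw [hl] at hl3
    split_ifs at hkl with h1 h2 h2
    · exact Fin.castSucc_injective _ hkl
    · rw [← hkl] at hE
      have := (isE_cs hE).2
      rw [this] at hk
      simp only at hk
      omega
    · rw [hkl] at hE
      have := (isE_cs hE).2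
      rw [this] at hl
      simp only at hl
      omega
    · exact T.inj (Prod.ext (hk.trans hl.symm) (by omega))

lemma rem_rows (hv : VP T v) {i : ℕ} (hi : i = 1 ∨ 0 < lam.parts (i - 1))
    {s : Fin (m + 1) → ℕ} (hs : v s ≠ 0) (hK : Kc T i s) {z : Fin (m + 1)} (hz : i ≤ Tt T z) :
    s z = 0 ∨ i ≤ s z := by
  by_contra hc
  push Not at hc
  have h1 := Tt_card (T := T) hi (j := s z) (by omega) hc.2
  have h2 := hv.sizes s hs (s z)
  rw [if_neg hc.1] at h2
  have h3 : (Finset.univ.filter fun w => Tt T w = s z) = Finset.univ.filter fun w => s w = s z := by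
    apply Finset.eq_of_subset_of_card_le
    · intro w hw
      simp only [Finset.mem_filter, Finset.mem_univ, true_and] at hw ⊢
      rw [← hw]
      exact hK w (by omega)
    · rw [h2]; exact h1
  have h4 : z ∈ Finset.univ.filter fun w => s w = s z := by simp
  rw [← h3] at h4
  simp only [Finset.mem_filter, Finset.mem_univ, true_and] at h4
  omega

/-- Pigeonhole on columns. -/
lemma col_card (hv : VP T v) {s : Fin (m + 1) → ℕ} (hs : v s ≠ 0) {a : ℕ} (A : Finset (Fin m))
    (U : Finset ℕ) (hA : ∀ k ∈ A, s (Fin.castSucc k) = a ∧ (T.pos k).2 ∈ U) :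
    A.card ≤ U.card := by
  apply Finset.card_le_card_of_injOn (fun k => (T.pos k).2)
  · intro k hk
    exact (hA k hk).2
  · intro k hk l hl hkl
    by_contra hne
    exact hs (hv.conf k l hne hkl s (by rw [(hA k hk).1, (hA l hl).1]))

lemma pigeon (hv : VP T v) {s : Fin (m + 1) → ℕ} (hs : v s ≠ 0) {a : ℕ} (ha : 1 ≤ a)
    (h : ∀ z, s z = a → ∃ k, z = Fin.castSucc k ∧ (T.pos k).2 ≤ lam.parts a) {c : ℕ}
    (hc : 1 ≤ c) (hc2 : c ≤ lam.parts a) : ∃ k, s (Fin.castSucc k) = a ∧ (T.pos k).2 = c := by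
  classical
  by_contra hno
  push Not at hno
  set A := Finset.univ.filter fun k : Fin m => s (Fin.castSucc k) = a with hA
  have h1 : lam.parts a ≤ A.card := by
    have h2 := hv.sizes s hs a
    rw [if_neg (by omega)] at h2
    rw [← h2, ← Finset.card_image_of_injective A (Fin.castSucc_injective m)]
    apply Finset.card_le_card
    intro z hz
    simp only [Finset.mem_filter, Finset.mem_univ, true_and] at hz
    obtain ⟨k, rfl, _⟩ := h z hz
    rw [Finset.mem_image]
    exact ⟨k, by simp [hA, hz], rfl⟩
  have h3 := col_card hv hs (a := a) A ((Finset.Icc 1 (lam.parts a)).erase c) (by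
    intro k hk
    simp only [hA, Finset.mem_filter, Finset.mem_univ, true_and] at hk
    obtain ⟨l, hl, hl2⟩ := h _ hk
    rw [Fin.castSucc_inj] at hl
    subst hl
    refine ⟨hk, ?_⟩
    rw [Finset.mem_erase, Finset.mem_Icc]
    exact ⟨hno k hk, (T.mem k).2.1, hl2⟩)
  rw [Finset.card_erase_of_mem (by rw [Finset.mem_Icc]; omega), Nat.card_Icc] at h3
  omega

lemma pigeon2 (hv : VP T v) {s : Fin (m + 1) → ℕ} (hs : v s ≠ 0) {a : ℕ} (ha : 1 ≤ a)
    {E : Fin (m + 1)}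
    (h : ∀ z, s z = a → z = E ∨ ∃ k, z = Fin.castSucc k ∧ (T.pos k).2 ≤ lam.parts a) {c d : ℕ}
    (hc : 1 ≤ c) (hcd : c < d) (hd : d ≤ lam.parts a)
    (hno : ∀ k, (T.pos k).2 = c → s (Fin.castSucc k) ≠ a) :
    ∃ k, s (Fin.castSucc k) = a ∧ (T.pos k).2 = d := by
  classical
  by_contra hno2
  push Not at hno2
  set A := Finset.univ.filter fun k : Fin m => s (Fin.castSucc k) = a ∧ Fin.castSucc k ≠ E with hA
  have h1 : lam.parts a ≤ A.card + 1 := by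
    have h2 := hv.sizes s hs a
    rw [if_neg (by omega)] at h2
    rw [← h2, ← Finset.card_image_of_injective A (Fin.castSucc_injective m)]
    refine le_trans (Finset.card_le_card ?_) (Finset.card_insert_le E _)
    intro z hz
    simp only [Finset.mem_filter, Finset.mem_univ, true_and] at hz
    rw [Finset.mem_insert]
    by_cases hzE : z = E
    · exact Or.inl hzE
    · right
      obtain ⟨k, rfl, _⟩ := (h z hz).resolve_left hzE
      rw [Finset.mem_image]
      exact ⟨k, by simp [hA, hz, hzE], rfl⟩
  have h3 := col_card hv hs (a := a) A (((Finset.Icc 1 (lam.parts a)).erase c).erase d) (by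
    intro k hk
    simp only [hA, Finset.mem_filter, Finset.mem_univ, true_and] at hk
    obtain ⟨l, hl, hl2⟩ := (h _ hk.1).resolve_left hk.2
    rw [Fin.castSucc_inj] at hl
    subst hl
    refine ⟨hk.1, ?_⟩
    rw [Finset.mem_erase, Finset.mem_erase, Finset.mem_Icc]
    exact ⟨hno2 k hk.1, fun h => hno k h hk.1, (T.mem k).2.1, hl2⟩)
  rw [Finset.card_erase_of_mem, Finset.card_erase_of_mem, Nat.card_Icc] at h3
  · omega
  · rw [Finset.mem_Icc]; omega
  · rw [Finset.mem_erase, Finset.mem_Icc]; omega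

variable (T) in
/-- The test functions. -/
def Sfun (i : ℕ) : Fin (m + 1) → ℕ := Fin.snoc (α := fun _ => ℕ)
  (fun k => if Tt T (Fin.castSucc k) < i then Tt T (Fin.castSucc k) else
    if (T.pos k).1 < i then 0 else (T.pos k).1) (if i = 1 then 0 else 1)

lemma col_le {i : ℕ} {k : Fin m} (hi : 1 ≤ i) (h : i ≤ (T.pos k).1) :
    (T.pos k).2 ≤ lam.parts i :=
  (T.mem k).2.2.trans (lam.antitone hi h)

lemma stepA (hv : VP T v) {i : ℕ} (hi : 1 ≤ i) (hi2 : i = 1 ∨ 0 < lam.parts (i - 1))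
    {E : Fin (m + 1)} (hE : isE T i E) (hS : v (Sfun T i) = 0) :
    ∀ n, ∀ s : Fin (m + 1) → ℕ, (Finset.univ.filter fun k : Fin m =>
      i ≤ (T.pos k).1 ∧ s (Fin.castSucc k) ≠ (T.pos k).1).card = n →
      Kc T i s → s E = 0 → v s = 0 := by
  intro n
  induction n using Nat.strong_induction_on with
  | _ n ih =>
  intro s hn hK hsE
  by_contra hs
  set M := Finset.univ.filter fun k : Fin m =>
      i ≤ (T.pos k).1 ∧ s (Fin.castSucc k) ≠ (T.pos k).1 with hM
  rcases M.eq_empty_or_nonempty with hemp | hne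
  · apply hs
    rw [← hS]
    congr 1
    funext z
    induction z using Fin.lastCases with
    | last =>
      simp only [Sfun, Fin.snoc_last]
      split_ifs with h
      · rcases hE with ⟨_, rfl⟩ | ⟨h2, _⟩
        · exact hsE
        · omega
      · rw [hK _ (by rw [Tt_last]; omega), Tt_last]
    | cast k =>
      simp only [Sfun, Fin.snoc_castSucc]
      split_ifs with h h2
      · exact hK _ h
      · rcases rem_cases hE hi (not_lt.1 h) with h3 | ⟨l, hl, h3⟩
        · rw [h3, hsE]
        · rw [Fin.castSucc_inj] at hl
          subst hl
          omega
      · by_contra h3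
        have : k ∈ M := by
          simp only [hM, Finset.mem_filter, Finset.mem_univ, true_and]
          exact ⟨by omega, h3⟩
        rw [hemp] at this
        simp at this
  · obtain ⟨k, hk, hmin⟩ := Finset.exists_min_image M (fun k => (T.pos k).1) hne
    have hk0 := hk
    simp only [hM, Finset.mem_filter, Finset.mem_univ, true_and] at hk
    obtain ⟨l, hl, hlc⟩ := pigeon hv hs (a := (T.pos k).1) (by omega) (by
      intro z hz
      have h1 : i ≤ Tt T z := Kc_ge hK (by omega)
      rcases rem_cases hE hi h1 with rfl | ⟨l, rfl, h3⟩
      · omega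
      · refine ⟨l, rfl, col_le (by omega) ?_⟩
        by_contra h4
        have h5 : l ∈ M := by
          simp only [hM, Finset.mem_filter, Finset.mem_univ, true_and]
          exact ⟨h3, by omega⟩
        have := hmin l h5
        omega) (T.mem k).2.1 (T.mem k).2.2
    have hlk : k ≠ l := by
      rintro rfl
      exact hk.2 hl
    have hlT : i ≤ Tt T (Fin.castSucc l) := Kc_ge hK (by omega)
    have hlE : Fin.castSucc l ≠ E := by
      rintro h
      rw [h] at hl
      omega
    have hkE : Fin.castSucc k ≠ E := by
      rintro rfl
      have := (isE_cs hE)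
      rw [this.2] at hk
      simp only at hk
      omega
    have hlr : i ≤ (T.pos l).1 := by
      rcases rem_cases hE hi hlT with h | ⟨l', hl', h⟩
      · exact absurd h hlE
      · rw [Fin.castSucc_inj] at hl'
        subst hl'
        exact h
    have hlr2 : (T.pos l).1 ≠ (T.pos k).1 := fun h => hlk (T.inj (Prod.ext h hlc)).symm
    apply hs
    apply swap_zero hv hlk hlc.symm
    refine ih _ ?_ _ rfl (Kc_swap hK (cs_Tt_ge hk.1) hlT) ?_
    · rw [← hn]
      apply Finset.card_lt_card
      rw [Finset.ssubset_iff_of_subset]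
      · refine ⟨k, hk0, ?_⟩
        simp only [Finset.mem_filter, Finset.mem_univ, true_and, Function.comp_apply, usw_left]
        tauto
      · intro z hz
        simp only [Finset.mem_filter, Finset.mem_univ, true_and, Function.comp_apply] at hz
        simp only [hM, Finset.mem_filter, Finset.mem_univ, true_and]
        refine ⟨hz.1, ?_⟩
        by_cases h1 : z = k
        · subst h1; exact hk.2
        · by_cases h2 : z = l
          · subst h2
            rw [hl]
            exact hlr2.symm
          · rw [usw_ne (by simpa using h1) (by simpa using h2)] at hz
            exact hz.2
    · rw [Function.comp_apply, usw_ne hkE.symm hlE.symm, hsE]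

lemma Tt_eq_cases {i : ℕ} {E : Fin (m + 1)} (hE : isE T i E) (hi : 1 ≤ i) {z : Fin (m + 1)}
    (hz : Tt T z = i) :
    z = E ∨ ∃ k, z = Fin.castSucc k ∧ (T.pos k).1 = i ∧ (T.pos k).2 < lam.parts i := by
  rcases rem_cases hE hi hz.ge with h | ⟨k, rfl, h⟩
  · exact Or.inl h
  · right
    have := Tt_cs T k
    have h2 : (T.pos k).1 = i := by omega
    rw [h2] at this
    exact ⟨k, rfl, h2, by omega⟩

lemma stepB (hv : VP T v) {i : ℕ} (hi : 1 ≤ i)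
    {E : Fin (m + 1)} (hE : isE T i E) (hadd : i = 1 ∨ lam.parts i < lam.parts (i - 1))
    (hnext : ∀ s, Kc T (i + 1) s → v s = 0) :
    ∀ n, ∀ s : Fin (m + 1) → ℕ, (Finset.univ.filter fun k : Fin m =>
      (T.pos k).1 = i ∧ (T.pos k).2 < lam.parts i ∧ s (Fin.castSucc k) ≠ i).card = n →
      Kc T i s → s E = i → v s = 0 := by
  have hEcol : ∀ k, (T.pos k).2 ≤ lam.parts i → Fin.castSucc k ≠ E := by
    rintro k hk rfl
    have := isE_cs hE
    rw [this.2] at hk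
    simp only at hk
    omega
  intro n
  induction n using Nat.strong_induction_on with
  | _ n ih =>
  -- first case as an auxiliary claim
  have claim : ∀ s : Fin (m + 1) → ℕ, (Finset.univ.filter fun k : Fin m =>
      (T.pos k).1 = i ∧ (T.pos k).2 < lam.parts i ∧ s (Fin.castSucc k) ≠ i).card ≤ n →
      Kc T i s → s E = i → ∀ k l, (T.pos k).1 = i → (T.pos k).2 < lam.parts i →
      s (Fin.castSucc k) ≠ i → (T.pos l).2 = (T.pos k).2 → s (Fin.castSucc l) = i → v s = 0 := by
    intro s hn hK hsE k l hk1 hk2 hk3 hlc hl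
    have hkl : k ≠ l := by
      rintro rfl
      exact hk3 hl
    have hlr : (T.pos l).1 ≠ i := fun h => hkl (T.inj (Prod.ext (h.trans hk1.symm) hlc)).symm
    apply swap_zero hv hkl hlc.symm
    refine ih _ ?_ _ rfl (Kc_swap hK (cs_Tt_ge hk1.ge) (Kc_ge hK hl.ge)) ?_
    · refine lt_of_lt_of_le ?_ hn
      apply Finset.card_lt_card
      rw [Finset.ssubset_iff_of_subset]
      · refine ⟨k, by simp [hk1, hk2, hk3], ?_⟩
        simp only [Finset.mem_filter, Finset.mem_univ, true_and, Function.comp_apply, usw_left]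
        tauto
      · intro z hz
        simp only [Finset.mem_filter, Finset.mem_univ, true_and, Function.comp_apply] at hz ⊢
        refine ⟨hz.1, hz.2.1, ?_⟩
        by_cases h1 : z = k
        · subst h1; exact hk3
        · by_cases h2 : z = l
          · subst h2
            exact absurd hz.1 hlr
          · rw [usw_ne (by simpa using h1) (by simpa using h2)] at hz
            exact hz.2.2
    · rw [Function.comp_apply, usw_ne (hEcol k hk2.le).symm (hEcol l (by omega)).symm, hsE]
  intro s hn hK hsE
  by_contra hs
  set M := Finset.univ.filter fun k : Fin m =>
      (T.pos k).1 = i ∧ (T.pos k).2 < lam.parts i ∧ s (Fin.castSucc k) ≠ i with hM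
  rcases M.eq_empty_or_nonempty with hemp | ⟨k, hk⟩
  · apply hs
    apply hnext
    intro z hz
    by_cases hz2 : Tt T z < i
    · exact hK z hz2
    · have hz3 : Tt T z = i := by omega
      rw [hz3]
      rcases Tt_eq_cases hE hi hz3 with rfl | ⟨k, rfl, h1, h2⟩
      · exact hsE
      · by_contra h3
        have : k ∈ M := by simp [hM, h1, h2, h3]
        rw [hemp] at this
        simp at this
  · simp only [hM, Finset.mem_filter, Finset.mem_univ, true_and] at hk
    obtain ⟨hk1, hk2, hk3⟩ := hk
    by_cases hcol : ∃ l, (T.pos l).2 = (T.pos k).2 ∧ s (Fin.castSucc l) = i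
    · obtain ⟨l, hl1, hl2⟩ := hcol
      exact hs (claim s hn.le hK hsE k l hk1 hk2 hk3 hl1 hl2)
    · push Not at hcol
      obtain ⟨x, hx, hxc⟩ := pigeon2 hv hs hi (E := E) (by
        intro z hz
        rcases rem_cases hE hi (Kc_ge hK hz.ge) with h | ⟨l, rfl, h3⟩
        · exact Or.inl h
        · exact Or.inr ⟨l, rfl, col_le hi h3⟩) (T.mem k).2.1 hk2 le_rfl hcol
      apply hs
      rw [← hv.garnir x (T.pos k).2 (by omega)
        (fun a => cells_left (T.mem k).2.1 (by omega)) s]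
      apply Finset.sum_eq_zero
      intro y hy
      rw [mem_colF] at hy
      have hyx : y ≠ x := by
        rintro rfl
        omega
      by_cases hyT : Tt T (Fin.castSucc y) < i
      · have hsy := hK _ hyT
        have hyt := Tt_cs T y
        have hyr : (T.pos y).1 < i := by omega
        have h1 := lam.antitone (i := (T.pos y).1) (j := i - 1) (by omega) (by omega)
        have h1' : lam.parts i < lam.parts (i - 1) := by omega
        have hyt2 : Tt T (Fin.castSucc y) = (T.pos y).1 := by omega
        obtain ⟨w, hw⟩ := T.surj ((T.pos y).1, lam.parts i)
          ⟨by simp only; omega, by simp only; omega, by simp only; omega⟩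
        have hwt := Tt_cs T w
        rw [hw] at hwt
        simp only at hwt
        have hwt2 : Tt T (Fin.castSucc w) = (T.pos y).1 := by omega
        have hsw := hK (Fin.castSucc w) (by omega)
        have hwx : w ≠ x := by
          rintro rfl
          omega
        have hwy : w ≠ y := by
          rintro rfl
          rw [hw] at hy
          simp only at hy
          omega
        apply hv.conf w x hwx (by rw [hw, hxc])
        rw [Function.comp_apply, Function.comp_apply, usw_right,
          usw_ne (by simpa using hwy) (by simpa using hwx), hsw, hsy, hwt2, hyt2]
      · have hsy : (s ∘ usw y x) (Fin.castSucc y) = i := by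
          rw [Function.comp_apply, usw_left, hx]
        have hsx : ∀ z, z ≠ y → z ≠ x → (s ∘ usw y x) (Fin.castSucc z) = s (Fin.castSucc z) := by
          intro z hz1 hz2
          rw [Function.comp_apply, usw_ne (by simpa using hz1) (by simpa using hz2)]
        have hK' : Kc T i (s ∘ usw y x) := Kc_swap hK (not_lt.1 hyT) (Kc_ge hK hx.ge)
        have hE' : (s ∘ usw y x) E = i := by
          rw [Function.comp_apply, usw_ne (hEcol y (by omega)).symm (hEcol x (by omega)).symm, hsE]
        have hsub : (Finset.univ.filter fun k : Fin m =>
            (T.pos k).1 = i ∧ (T.pos k).2 < lam.parts i ∧ (s ∘ usw y x) (Fin.castSucc k) ≠ i) ⊆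
            M := by
          intro z hz
          simp only [Finset.mem_filter, Finset.mem_univ, true_and] at hz
          simp only [hM, Finset.mem_filter, Finset.mem_univ, true_and]
          refine ⟨hz.1, hz.2.1, ?_⟩
          by_cases h1 : z = y
          · subst h1; exact absurd hsy hz.2.2
          · by_cases h2 : z = x
            · subst h2; omega
            · rw [← hsx z h1 h2]; exact hz.2.2
        by_cases hyk : y = k
        · subst hyk
          refine ih _ ?_ _ rfl hK' hE'
          rw [← hn]
          apply Finset.card_lt_card
          rw [Finset.ssubset_iff_of_subset hsub]
          refine ⟨y, by simp [hM, hk1, hk2, hk3], ?_⟩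
          simp only [Finset.mem_filter, Finset.mem_univ, true_and]
          tauto
        · refine claim _ ?_ hK' hE' k y hk1 hk2 ?_ hy hsy
          · rw [← hn]
            exact Finset.card_le_card hsub
          · rw [hsx k (Ne.symm hyk) (by rintro rfl; omega)]
            exact hk3

lemma stepC (hv : VP T v) {i : ℕ} (hi : 1 ≤ i) (hi2 : i = 1 ∨ 0 < lam.parts (i - 1))
    {E : Fin (m + 1)} (hE : isE T i E) (hadd : i = 1 ∨ lam.parts i < lam.parts (i - 1))
    (hS : v (Sfun T i) = 0)
    (hnext : 0 < lam.parts i → ∀ s, Kc T (i + 1) s → v s = 0) (s : Fin (m + 1) → ℕ)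
    (hK : Kc T i s) : v s = 0 := by
  classical
  by_contra hs
  have hET := isE_Tt hE
  rcases rem_rows hv hi2 hs hK hET.ge with h0 | h1
  · exact hs (stepA hv hi hi2 hE hS _ s rfl hK h0)
  · have hpos : 0 < lam.parts i := by
      have h2 := hv.sizes s hs (s E)
      rw [if_neg (by omega)] at h2
      have h3 : 0 < lam.parts (s E) := by
        rw [← h2, Finset.card_pos]
        exact ⟨E, by simp⟩
      have := lam.antitone (i := i) (j := s E) hi h1
      omega
    have hB := stepB hv hi hE hadd (hnext hpos)
    by_cases h2 : s E = i
    · exact hs (hB _ s rfl hK h2)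
    · have hr := hv.row i (s E) hi (by omega) (Function.update s E i)
      rw [Finset.sum_eq_single E] at hr
      · apply hs
        simpa using hr
      · intro k hk hkE
        simp only [Finset.mem_filter, Finset.mem_univ, true_and] at hk
        rw [Function.update_of_ne hkE] at hk
        refine hB _ _ rfl ?_ ?_
        · intro z hz
          have hzE : z ≠ E := by rintro rfl; omega
          have hzk : z ≠ k := by
            rintro rfl
            have := hK z hz
            omega
          rw [Function.update_of_ne hzk, Function.update_of_ne hzE]
          exact hK z hz
        · rw [Function.update_of_ne hkE.symm, Function.update_self]
      · simp

lemma stepD (hv : VP T v) {i : ℕ} (hi : 1 ≤ i)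
    {E : Fin (m + 1)} (hE : isE T i E) (hnadd : ¬ (i = 1 ∨ lam.parts i < lam.parts (i - 1)))
    (hnext : ∀ s, Kc T (i + 1) s → v s = 0) :
    ∀ n, ∀ s : Fin (m + 1) → ℕ, (Finset.univ.filter fun z : Fin (m + 1) =>
      Tt T z = i ∧ s z ≠ i).card = n →
      Kc T i s → v s = 0 := by
  push Not at hnadd
  have hlam : lam.parts (i - 1) = lam.parts i := by
    have := lam.antitone (i := i - 1) (j := i) (by omega) (by omega)
    omega
  have hEk : ∃ kE, E = Fin.castSucc kE ∧ T.pos kE = (i - 1, lam.parts i) := by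
    rcases hE with ⟨h, _⟩ | ⟨_, k, h1, h2⟩
    · omega
    · exact ⟨k, h1, by rw [h2, hlam]⟩
  obtain ⟨kE, rfl, hkE⟩ := hEk
  have huniq : ∀ k l : Fin m, Tt T (Fin.castSucc k) = i → Tt T (Fin.castSucc l) = i →
      (T.pos k).2 = (T.pos l).2 → k = l := by
    intro k l hk hl hkl
    rcases Tt_eq_cases hE hi hk with h1 | ⟨k', h1, h2, h3⟩ <;>
    rcases Tt_eq_cases hE hi hl with h4 | ⟨l', h4, h5, h6⟩
    · exact Fin.castSucc_injective _ (h1.trans h4.symm)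
    · rw [Fin.castSucc_inj] at h1 h4
      subst h1 h4
      rw [hkE] at hkl
      simp only at hkl
      omega
    · rw [Fin.castSucc_inj] at h1 h4
      subst h1 h4
      rw [hkE] at hkl
      simp only at hkl
      omega
    · rw [Fin.castSucc_inj] at h1 h4
      subst h1 h4
      exact T.inj (Prod.ext (h2.trans h5.symm) hkl)
  intro n
  induction n using Nat.strong_induction_on with
  | _ n ih =>
  intro s hn hK
  by_contra hs
  set M := Finset.univ.filter fun z : Fin (m + 1) => Tt T z = i ∧ s z ≠ i with hM
  rcases M.eq_empty_or_nonempty with hemp | ⟨z, hz⟩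
  · apply hs
    apply hnext
    intro z hz
    by_cases hz2 : Tt T z < i
    · exact hK z hz2
    · by_contra h3
      have : z ∈ M := by
        simp only [hM, Finset.mem_filter, Finset.mem_univ, true_and]
        omega
      rw [hemp] at this
      simp at this
  · have hz0 := hz
    simp only [hM, Finset.mem_filter, Finset.mem_univ, true_and] at hz
    have hzk : ∃ k, z = Fin.castSucc k ∧ (T.pos k).2 ≤ lam.parts i := by
      rcases Tt_eq_cases hE hi hz.1 with rfl | ⟨k, h1, h2, h3⟩
      · exact ⟨kE, rfl, by rw [hkE]⟩
      · exact ⟨k, h1, h3.le⟩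
    obtain ⟨k, rfl, hkc⟩ := hzk
    obtain ⟨l, hl, hlc⟩ := pigeon hv hs hi (by
      intro z hz
      rcases rem_cases hE hi (Kc_ge hK hz.ge) with rfl | ⟨l, rfl, h3⟩
      · exact ⟨kE, rfl, by rw [hkE]⟩
      · exact ⟨l, rfl, col_le hi h3⟩) (T.mem k).2.1 hkc
    have hkl : k ≠ l := by
      rintro rfl
      exact hz.2 hl
    have hlT : Tt T (Fin.castSucc l) ≠ i := fun h => hkl (huniq k l hz.1 h hlc.symm)
    apply hs
    apply swap_zero hv hkl hlc.symm
    refine ih _ ?_ _ rfl (Kc_swap hK hz.1.ge (Kc_ge hK hl.ge))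
    rw [← hn]
    apply Finset.card_lt_card
    rw [Finset.ssubset_iff_of_subset]
    · refine ⟨_, hz0, ?_⟩
      simp only [Finset.mem_filter, Finset.mem_univ, true_and, Function.comp_apply, usw_left]
      tauto
    · intro w hw
      simp only [Finset.mem_filter, Finset.mem_univ, true_and, Function.comp_apply] at hw
      simp only [hM, Finset.mem_filter, Finset.mem_univ, true_and]
      refine ⟨hw.1, ?_⟩
      by_cases h1 : w = Fin.castSucc k
      · subst h1; exact hz.2
      · by_cases h2 : w = Fin.castSucc l
        · subst h2
          exact absurd hw.1 hlT
        · rw [usw_ne h1 h2] at hw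
          exact hw.2

lemma all_zero (hv : VP T v) (hS : ∀ i ∈ addRows lam, v (Sfun T i) = 0) :
    ∀ n i, m + 2 ≤ n + i → 1 ≤ i → (i = 1 ∨ 0 < lam.parts (i - 1)) →
      ∀ s, Kc T i s → v s = 0 := by
  intro n
  induction n with
  | zero =>
    intro i h1 h2 h3
    have := parts_pos_le (lam := lam) (a := i - 1) (by omega)
    omega
  | succ n ih =>
    intro i h1 h2 h3
    obtain ⟨E, hE⟩ := exists_E T h2 h3
    have hnext : 0 < lam.parts i → ∀ s, Kc T (i + 1) s → v s = 0 :=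
      fun h => ih (i + 1) (by omega) (by omega) (Or.inr h)
    by_cases hadd : i = 1 ∨ lam.parts i < lam.parts (i - 1)
    · exact stepC hv h2 h3 hE hadd (hS i (mem_addRows.2 ⟨h2, hadd⟩)) hnext
    · intro s hK
      exact stepD hv h2 hE hadd (hnext (by omega)) _ s rfl hK

lemma VP_zero (hv : VP T v) (hS : ∀ i ∈ addRows lam, v (Sfun T i) = 0) (s : Fin (m + 1) → ℕ) :
    v s = 0 := by
  refine all_zero hv hS (m + 2) 1 (by omega) le_rfl (Or.inl rfl) s ?_
  intro z hz
  have := Tt_pos T z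
  omega

end upper
end CarterPayne

namespace CarterPayne
open Finset

section algebraPart
open Polynomial

lemma alg_iso {F A : Type*} [Field F] [Ring A] [Algebra F A] [Module.Finite F A] (x : A)
    {P : Polynomial F} (hP : P.Monic) (h0 : Polynomial.aeval x P = 0)
    (hind : ∀ q : Polynomial F, Polynomial.aeval x q = 0 → q.natDegree < P.natDegree → q = 0)
    (hdim : Module.finrank F A ≤ P.natDegree) :
    Nonempty ((Polynomial F ⧸ Ideal.span ({P} : Set (Polynomial F))) ≃ₐ[F] A) := by
  have hker : ∀ q ∈ Ideal.span ({P} : Set (Polynomial F)), Polynomial.aeval x q = 0 := by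
    intro q hq
    obtain ⟨c, rfl⟩ := Ideal.mem_span_singleton.1 hq
    rw [map_mul, h0, zero_mul]
  let f : (Polynomial F ⧸ Ideal.span ({P} : Set (Polynomial F))) →ₐ[F] A :=
    Ideal.Quotient.liftₐ _ (Polynomial.aeval x) hker
  have hf : ∀ q, f (Ideal.Quotient.mk _ q) = Polynomial.aeval x q := fun q => rfl
  have hinj : Function.Injective f := by
    rw [injective_iff_map_eq_zero]
    intro a ha
    obtain ⟨q, rfl⟩ := Ideal.Quotient.mk_surjective a
    rw [hf] at ha
    rw [Ideal.Quotient.eq_zero_iff_mem, Ideal.mem_span_singleton,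
      ← Polynomial.modByMonic_eq_zero_iff_dvd hP]
    by_cases h1 : P = 1
    · rw [h1, Polynomial.modByMonic_one]
    apply hind
    · rw [Polynomial.modByMonic_eq_sub_mul_div, map_sub, map_mul, h0, ha, zero_mul, sub_zero]
    · exact Polynomial.natDegree_modByMonic_lt _ hP h1
  have hfin : Module.finrank F (Polynomial F ⧸ Ideal.span ({P} : Set (Polynomial F)))
      = P.natDegree := finrank_quotient_span_eq_natDegree
  have : Module.Finite F (Polynomial F ⧸ Ideal.span ({P} : Set (Polynomial F))) :=
    Module.Finite.of_injective f.toLinearMap hinj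
  have heq : Module.finrank F (Polynomial F ⧸ Ideal.span ({P} : Set (Polynomial F)))
      = Module.finrank F A := by
    apply le_antisymm
    · exact LinearMap.finrank_le_finrank_of_injective (f := f.toLinearMap) hinj
    · omega
  have hsurj : Function.Surjective f :=
    (LinearMap.injective_iff_surjective_of_finrank_eq_finrank (f := f.toLinearMap) heq).1 hinj
  exact ⟨AlgEquiv.ofBijective f ⟨hinj, hsurj⟩⟩

lemma Pp_monic {F : Type*} [Field F] {m : ℕ} (lam : Partition m) : (Pp F lam).Monic := by
  unfold Pp
  exact Polynomial.monic_prod_of_monic _ _ fun i _ => Polynomial.monic_X_sub_C _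

lemma Pp_deg {F : Type*} [Field F] {m : ℕ} (lam : Partition m) :
    (Pp F lam).natDegree = (addRows lam).card := by
  unfold Pp
  rw [Polynomial.natDegree_prod_of_monic _ _ fun i _ => Polynomial.monic_X_sub_C _]
  simp only [Polynomial.natDegree_X_sub_C, sum_const, smul_eq_mul, mul_one]

lemma Pp_eq {F : Type*} [Field F] (p : ℕ) [CharP F p] {m : ℕ} (lam : Partition m) :
    Pp F lam = ∏ r : ↥(addResSet lam p),
      (X - C (ZMod.castHom (dvd_refl p) F r.1)) ^ addResCount lam p r.1 := by
  rw [Finset.prod_coe_sort (addResSet lam p)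
    (fun r => (X - C (ZMod.castHom (dvd_refl p) F r)) ^ addResCount lam p r)]
  unfold Pp
  rw [← Finset.prod_fiberwise_of_maps_to (t := addResSet lam p)
    (g := fun i => (((lam.parts i : ℤ) + 1 - (i : ℤ) : ℤ) : ZMod p))
    (fun i hi => Finset.mem_image_of_mem _ hi)]
  apply Finset.prod_congr rfl
  intro r _
  unfold addResCount
  rw [← Finset.prod_const]
  apply Finset.prod_congr rfl
  intro i hi
  rw [← (Finset.mem_filter.1 hi).2, map_intCast (ZMod.castHom (dvd_refl p) F)]

lemma count_sum (p : ℕ) {m : ℕ} (lam : Partition m) :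
    ∑ r : ↥(addResSet lam p), addResCount lam p r.1 = (addRows lam).card := by
  rw [Finset.sum_coe_sort (addResSet lam p) (fun r => addResCount lam p r)]
  unfold addResCount
  exact (Finset.card_eq_sum_card_fiberwise (fun i hi => Finset.mem_image_of_mem _ hi)).symm

instance fin_quot {F : Type*} [Field F] (k : ℕ) : Module.Finite F
    (Polynomial F ⧸ Ideal.span ({(X : Polynomial F) ^ k} : Set (Polynomial F))) :=
  (Polynomial.monic_X_pow k).finite_quotient

lemma crt_dvd {F ι : Type*} [Field F] [Fintype ι] (c : ι → F) (hc : Function.Injective c)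
    (k : ι → ℕ) (q : Polynomial F) :
    (∏ i, (X - C (c i)) ^ k i) ∣ q ↔ ∀ i, (X - C (c i)) ^ k i ∣ q := by
  constructor
  · intro h r
    exact (Finset.dvd_prod_of_mem (fun i => (X - C (c i)) ^ k i) (Finset.mem_univ r)).trans h
  · intro h
    apply Finset.prod_dvd_of_coprime
    · intro a _ b _ hab
      apply IsCoprime.pow
      apply Polynomial.isCoprime_X_sub_C_of_isUnit_sub
      rw [isUnit_iff_ne_zero, sub_ne_zero]
      exact fun h2 => hab (hc h2)
    · intro r _
      exact h r

lemma shift_dvd {F : Type*} [Field F] (c : F) (k : ℕ) (q : Polynomial F) :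
    Polynomial.aeval (Ideal.Quotient.mkₐ F (Ideal.span ({X ^ k} : Set (Polynomial F)))
      (X + C c)) q = 0 ↔ (X - C c) ^ k ∣ q := by
  rw [Polynomial.aeval_algHom_apply, Ideal.Quotient.mkₐ_eq_mk, Ideal.Quotient.eq_zero_iff_mem,
    Ideal.mem_span_singleton]
  have e3 := map_dvd_iff (Polynomial.algEquivAevalXAddC c) (a := (X - C c) ^ k) (b := q)
  rw [← e3]
  simp

lemma crt_abs {F ι : Type*} [Field F] [Fintype ι] (c : ι → F) (hc : Function.Injective c)
    (k : ι → ℕ) :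
    Nonempty ((Polynomial F ⧸ Ideal.span ({∏ i, (X - C (c i)) ^ k i} : Set (Polynomial F)))
      ≃ₐ[F] ((i : ι) → Polynomial F ⧸ Ideal.span ({X ^ k i} : Set (Polynomial F)))) := by
  let x : (i : ι) → Polynomial F ⧸ Ideal.span ({X ^ k i} : Set (Polynomial F)) :=
    fun i => Ideal.Quotient.mkₐ F _ (X + C (c i))
  have hx : ∀ q : Polynomial F, Polynomial.aeval x q = 0 ↔ (∏ i, (X - C (c i)) ^ k i) ∣ q := by
    intro q
    rw [crt_dvd c hc, funext_iff]
    apply forall_congr'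
    intro i
    rw [← shift_dvd]
    have e1 : Polynomial.aeval x q i = Polynomial.aeval (x i) q :=
      (Polynomial.aeval_algHom_apply (Pi.evalAlgHom F _ i) x q).symm
    rw [e1]
    rfl
  have hdeg : (∏ i, (X - C (c i)) ^ k i).natDegree = ∑ i, k i := by
    rw [Polynomial.natDegree_prod_of_monic _ _ fun i _ => (Polynomial.monic_X_sub_C _).pow _]
    simp
  apply alg_iso x (Polynomial.monic_prod_of_monic _ _ fun i _ => (Polynomial.monic_X_sub_C _).pow _)
    ((hx _).2 dvd_rfl)
  · intro q hq hd
    exact Polynomial.eq_zero_of_dvd_of_natDegree_lt ((hx q).1 hq) hd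
  · rw [Module.finrank_pi_fintype, hdeg]
    apply Finset.sum_le_sum
    intro r _
    rw [finrank_quotient_span_eq_natDegree, Polynomial.natDegree_X_pow]

lemma crt_iso (F : Type*) [Field F] (p : ℕ) [CharP F p] {m : ℕ} (lam : Partition m) :
    Nonempty ((Polynomial F ⧸ Ideal.span ({Pp F lam} : Set (Polynomial F))) ≃ₐ[F]
      ((r : ↥(addResSet lam p)) →
        Polynomial F ⧸ Ideal.span ({Polynomial.X ^ (addResCount lam p r.1)} : Set (Polynomial F)))) := by
  rw [Pp_eq p]
  exact crt_abs (fun r : ↥(addResSet lam p) => ZMod.castHom (dvd_refl p) F r.1)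
    (fun a b h => Subtype.ext (ZMod.castHom_injective F h)) (fun r => addResCount lam p r.1)

lemma sub_iso {F V : Type*} [Field F] [AddCommMonoid V] [Module F V]
    (S : Subalgebra F (Module.End F V)) (L : Module.End F V) (hL : L ∈ S)
    {P : Polynomial F} (hP : P.Monic) (h0 : Polynomial.aeval L P = 0)
    (hind : ∀ q : Polynomial F, Polynomial.aeval L q = 0 → q.natDegree < P.natDegree → q = 0)
    {ι : Type*} [Fintype ι] (c : ι → V →ₗ[F] F) (e : V)
    (hinj : ∀ Φ ∈ S, (∀ i, c i (Φ e) = 0) → Φ = 0) (hcard : Fintype.card ι ≤ P.natDegree) :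
    Nonempty ((Polynomial F ⧸ Ideal.span ({P} : Set (Polynomial F))) ≃ₐ[F] ↥S) := by
  letI : Ring ↥S := Algebra.semiringToRing F
  let g : ↥S →ₗ[F] (ι → F) :=
    { toFun := fun Φ i => c i (Φ.1 e)
      map_add' := fun Φ Ψ => by funext i; simp
      map_smul' := fun r Φ => by funext i; simp }
  have hg : Function.Injective g := by
    rw [injective_iff_map_eq_zero]
    intro Φ h
    exact Subtype.ext (hinj Φ.1 Φ.2 fun i => congrFun h i)
  have : Module.Finite F ↥S := Module.Finite.of_injective g hg
  have hc : ∀ q : Polynomial F,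
      Polynomial.aeval (⟨L, hL⟩ : ↥S) q = 0 ↔ Polynomial.aeval L q = 0 := by
    intro q
    have h1 := Polynomial.aeval_subalgebra_coe q S ⟨L, hL⟩
    rw [Subtype.ext_iff, h1]
    rfl
  apply alg_iso (⟨L, hL⟩ : ↥S) hP ((hc _).2 h0)
  · intro q hq hd
    exact hind q ((hc q).1 hq) hd
  · have := LinearMap.finrank_le_finrank_of_injective hg
    rw [Module.finrank_fintype_fun_eq_card] at this
    omega

end algebraPart

section fin
variable {F : Type*} [Field F] {m : ℕ} {lam : Partition m}

lemma two_ne (F : Type*) [Field F] (p : ℕ) [CharP F p] (hp : p ≠ 2) : (2 : F) ≠ 0 := by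
  intro h
  have h1 : ((2 : ℕ) : F) = 0 := by exact_mod_cast h
  rw [CharP.cast_eq_zero_iff F p] at h1
  rcases (Nat.dvd_prime Nat.prime_two).1 h1 with h2 | h2
  · exact CharP.char_ne_one F p h2
  · exact hp h2

lemma VP_End (h2 : (2 : F) ≠ 0) (T : Placement lam) {Φ : Module.End F ↥(indSpecht F lam)}
    (hΦ : Φ ∈ EndInd F lam) : VP T (fun s => vv (Φ (gen F T)) s) := by
  have hg := (good_gen (F := F) T).map (mem_EndInd.1 hΦ)
  have hanti : ∀ y z, y ≠ z → (T.pos y).2 = (T.pos z).2 → ∀ s,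
      vv (Φ (gen F T)) (s ∘ usw y z) = - vv (Φ (gen F T)) s := by
    intro y z hyz hc s
    rw [← vv_act, ← vv_neg]
    exact congrArg (fun f => vv f s) (hg.anti y z hyz hc)
  refine ⟨hanti, ?_, ?_, ?_, ?_⟩
  · intro x c hx hc s
    have h := congrArg (fun f => vv f s) (hg.garnir x c hx hc)
    refine Eq.trans ?_ h
    refine Eq.trans ?_ (vv_sum _ _ s).symm
    exact Finset.sum_congr rfl fun y _ => (vv_act _ _ _).symm
  · intro a b ha hab s
    exact vv_row _ ha hab s
  · intro s hs i
    exact vv_sizes hs i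
  · intro y z hyz hc s hs
    have h := hanti y z hyz hc s
    have e : s ∘ usw y z = s := by
      funext k
      unfold usw
      simp only [Function.comp_apply]
      rw [Equiv.swap_apply_def]
      split_ifs with ha hb
      · rw [ha, hs]
      · rw [hb, hs]
      · rfl
    rw [e] at h
    have : (2 : F) * vv (Φ (gen F T)) s = 0 := by linear_combination h
    exact (mul_eq_zero.1 this).resolve_left h2

lemma end_iso (h2 : (2 : F) ≠ 0) :
    Nonempty ((Polynomial F ⧸ Ideal.span ({Pp F lam} : Set (Polynomial F))) ≃ₐ[F]
      ↥(EndInd F lam)) := by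
  obtain ⟨T⟩ := exists_placement lam
  refine sub_iso (EndInd F lam) (LL F lam) LL_mem (Pp_monic lam) annihilate ?_
    (fun i : ↥(addRows lam) => vvL F lam (Sfun T i.1)) (gen F T) ?_ ?_
  · intro q hq hd
    rw [Pp_deg] at hd
    exact indep hq hd
  · intro Φ hΦ h
    apply EndInd_zero T hΦ
    apply vv_ext
    intro s
    rw [vv_zero]
    exact VP_zero (VP_End h2 T hΦ) (fun i hi => h ⟨i, hi⟩) s
  · rw [Fintype.card_coe, Pp_deg]

end fin

end CarterPayne

namespace CarterPayne
open Finset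

/-- Let `F` be a field of characteristic `p ≠ 2` and `λ` a partition of
`n-1` (below, `n = m+1`).  Then the blocks of `End_{FΣ_n}(S^λ↑^{Σ_n})` are parametrized
by the `p`-residues of the addable nodes of `[λ]`: the algebra is isomorphic to the
product, over the `p`-residues `r` of addable nodes, of the truncated polynomial rings
`F[x]/(x^{m_r})`, where `m_r` is the number of addable nodes of `[λ]` of `p`-residue `r`
(in particular each block has `F`-dimension `m_r`). -/
theorem stmt3 (F : Type*) [Field F] (p : ℕ) [CharP F p] (hp : p ≠ 2)
    {m : ℕ} (lam : Partition m) :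
    Nonempty (↥(EndInd F lam) ≃ₐ[F]
      ((r : ↥(addResSet lam p)) →
        Polynomial F ⧸ Ideal.span ({Polynomial.X ^ (addResCount lam p r.1)} : Set (Polynomial F)))) := by
  obtain ⟨e1⟩ := end_iso (lam := lam) (two_ne F p hp)
  obtain ⟨e2⟩ := crt_iso F p lam
  exact ⟨e1.symm.trans e2⟩

end CarterPayne
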